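/- arXiv:2603.24915 — 9 statements merged into one kernel-verified Lean document; each statement's English description precedes it below -/
import Mathlib

section
/- Let ℓ be a prime and α ∈ (ℤ/ℓℤ)ˣ. If ℓ is odd, then |X_ℓ^α| = ℓ² when α = 1 and |X_ℓ^α| = ℓ² + ℓ when α ≠ 1. If ℓ = 2, then |X_2^1| = 4. -/
open Matrix

/-- For a positive integer `n` and a unit `α ∈ (ℤ/nℤ)ˣ`, `Xset n α` is the set of
matrices `M ∈ GL₂(ℤ/nℤ)` with `det (I − M) = 0` and `det M = α`. -/
def Xset (n : ℕ) (α : (ZMod n)ˣ) : Set (GL (Fin 2) (ZMod n)) :=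
  {M | ((1 : Matrix (Fin 2) (Fin 2) (ZMod n)) -
          (M : Matrix (Fin 2) (Fin 2) (ZMod n))).det = 0 ∧
       (M : Matrix (Fin 2) (Fin 2) (ZMod n)).det = (α : ZMod n)}

/-- Over a finite field, the solutions of `b * c = f a` are counted by
`q * (q - 1)` plus `q` times the number of zeros of `f`. -/
theorem card_mul_eq_apply {F : Type*} [Field F] [Fintype F] [DecidableEq F] (f : F → F) :
    Fintype.card {p : F × F × F // p.1 * p.2.2 = f p.2.1} =
      (Fintype.card F - 1) * Fintype.card F +
        Fintype.card F * (Finset.univ.filter fun a => f a = 0).card := by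
  have fibre (b a : F) : (∑ c : F, if b * c = f a then 1 else 0) =
      if b = 0 then (if f a = 0 then Fintype.card F else 0) else 1 := by
    split_ifs with hb ha
    · simp [hb, ha]
    · simp [hb, Ne.symm ha]
    · have h (c : F) : b * c = f a ↔ c = b⁻¹ * f a := (eq_inv_mul_iff_mul_eq₀ hb).symm
      simp [h]
  rw [Fintype.card_subtype, Finset.card_filter, Fintype.sum_prod_type]
  simp only [Fintype.sum_prod_type, fibre]
  rw [← Finset.add_sum_erase Finset.univ _ (Finset.mem_univ (0 : F)),
    Finset.sum_congr (s₁ := Finset.univ.erase (0 : F)) rfl (g := fun _ => Fintype.card F)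
      (fun b hb => by simp [Finset.ne_of_mem_erase hb])]
  rw [Finset.sum_const, Finset.card_erase_of_mem (Finset.mem_univ _), Finset.card_univ]
  simp [Finset.sum_ite, mul_comm, add_comm]

/-- A matrix in `Xset n α` is determined by its entries `b, a, c`, as its trace is `1 + α`. -/
noncomputable def xsetEquiv (n : ℕ) (α : (ZMod n)ˣ) :
    Xset n α ≃ {p : ZMod n × ZMod n × ZMod n // p.1 * p.2.2 = (p.2.1 - 1) * (α - p.2.1)} where
  toFun M := ⟨(M.1.1 0 1, M.1.1 0 0, M.1.1 1 0), by
    obtain ⟨M, h1, h2⟩ := M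
    simp only [det_fin_two, Matrix.sub_apply] at h1 h2
    simp at h1 ⊢
    linear_combination (M.1 0 0 - 1) * h2 - M.1 0 0 * h1⟩
  invFun p := ⟨GeneralLinearGroup.mk'' !![p.1.2.1, p.1.1; p.1.2.2, 1 + α - p.1.2.1] (by
    have h : (!![p.1.2.1, p.1.1; p.1.2.2, 1 + α - p.1.2.1]).det = (α : ZMod n) := by
      rw [det_fin_two_of]
      linear_combination -p.2
    rw [h]
    exact α.isUnit), by
    constructor
    · simp [det_fin_two]
      linear_combination -p.2
    · simp [det_fin_two]
      linear_combination -p.2⟩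
  left_inv M := by
    obtain ⟨M, h1, h2⟩ := M
    simp only [det_fin_two, Matrix.sub_apply] at h1 h2
    simp at h1
    apply Subtype.ext
    apply Units.ext
    ext i j
    fin_cases i <;> fin_cases j <;> simp
    linear_combination h1 - h2
  right_inv p := by
    simp

theorem card_Xset_eq (ℓ : ℕ) [Fact ℓ.Prime] (α : (ZMod ℓ)ˣ) :
    Nat.card (Xset ℓ α) = (ℓ - 1) * ℓ + ℓ * ({1, (α : ZMod ℓ)} : Finset (ZMod ℓ)).card := by
  rw [Nat.card_congr (xsetEquiv ℓ α), Nat.card_eq_fintype_card,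
    card_mul_eq_apply (fun a : ZMod ℓ => (a - 1) * (α - a)), ZMod.card]
  congr 3
  ext a
  simp [sub_eq_zero, eq_comm (a := a)]

/-- Let `ℓ` be a prime and `α ∈ (ℤ/ℓℤ)ˣ`. If `ℓ` is odd, then
`|X_ℓ^α| = ℓ²` when `α = 1` and `|X_ℓ^α| = ℓ² + ℓ` when `α ≠ 1`. If `ℓ = 2`, then
`|X_ℓ^α| = 4` (note `α = 1` is automatic in `(ℤ/2ℤ)ˣ`). -/
theorem card_Xset_prime (ℓ : ℕ) (hℓ : ℓ.Prime) (α : (ZMod ℓ)ˣ) :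
    (Odd ℓ →
      (α = 1 → Nat.card (Xset ℓ α) = ℓ ^ 2) ∧
      (α ≠ 1 → Nat.card (Xset ℓ α) = ℓ ^ 2 + ℓ)) ∧
    (ℓ = 2 → Nat.card (Xset ℓ α) = 4) := by
  have : Fact ℓ.Prime := ⟨hℓ⟩
  obtain ⟨k, rfl⟩ := Nat.exists_eq_add_of_le' hℓ.one_le
  have card_one (h : α = 1) : Nat.card (Xset (k + 1) α) = (k + 1) ^ 2 := by
    rw [card_Xset_eq, h]
    simp
    ring
  refine ⟨fun _ => ⟨card_one, fun h => ?_⟩, fun h => ?_⟩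
  · have h' : (1 : ZMod (k + 1)) ≠ α := fun e => h (Units.ext e.symm)
    rw [card_Xset_eq, Finset.card_pair h', Nat.add_sub_cancel]
    ring
  · obtain rfl : k = 1 := by omega
    exact card_one (Subsingleton.elim (α := (ZMod 2)ˣ) _ _)
end

section
/- Let ℓ be a prime and let 𝓑_ℓ = {(M₁, M₂) ∈ Δ(ℤ/ℓℤ) : det(I − M₁) = 0 and det(I − M₂) = 0}. Then |𝓑_ℓ| = ℓ²(ℓ + 2)(ℓ² − ℓ − 1). -/
open Matrix

/-- For a commutative ring `R` (here `ZMod n`), `Δ(R)` is the set of pairs of matrices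
`(M₁, M₂) ∈ GL₂(R) × GL₂(R)` with `det M₁ = det M₂`. -/
def DeltaPairs (n : ℕ) : Set (GL (Fin 2) (ZMod n) × GL (Fin 2) (ZMod n)) :=
  {P | ((P.1 : Matrix (Fin 2) (Fin 2) (ZMod n))).det =
       ((P.2 : Matrix (Fin 2) (Fin 2) (ZMod n))).det}

/-- `𝓑_n` is the set of pairs `(M₁, M₂) ∈ Δ(ℤ/nℤ)` with
`det (I − M₁) = 0` and `det (I − M₂) = 0`. -/
def Bset (n : ℕ) : Set (GL (Fin 2) (ZMod n) × GL (Fin 2) (ZMod n)) :=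
  {P | P ∈ DeltaPairs n ∧
       ((1 : Matrix (Fin 2) (Fin 2) (ZMod n)) -
          (P.1 : Matrix (Fin 2) (Fin 2) (ZMod n))).det = 0 ∧
       ((1 : Matrix (Fin 2) (Fin 2) (ZMod n)) -
          (P.2 : Matrix (Fin 2) (Fin 2) (ZMod n))).det = 0}

section FiniteField

variable {F : Type*} [Field F]

lemma mul_eq_of_det_eq_of_det_one_sub_eq_zero {M : Matrix (Fin 2) (Fin 2) F} {d : F}
    (h : M.det = d) (h' : (1 - M).det = 0) : M 0 1 * M 1 0 = (M 0 0 - 1) * (d - M 0 0) ∧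
      M 1 1 = 1 + d - M 0 0 := by
  simp only [Matrix.det_fin_two, Matrix.sub_apply, Matrix.one_apply_eq, ne_eq, zero_ne_one,
    one_ne_zero, not_false_eq_true, Matrix.one_apply_ne] at h h'
  constructor <;> grind

/-- A matrix in `GL₂(F)` with determinant `d` and eigenvalue `1` is determined by its entries
other than the lower right one. -/
noncomputable def eigenvalueOneEquiv (d : Fˣ) :
    {M : GL (Fin 2) F // (M : Matrix (Fin 2) (Fin 2) F).det = d ∧
      (1 - (M : Matrix (Fin 2) (Fin 2) F)).det = 0} ≃
    {x : F × F × F // x.2.1 * x.2.2 = (x.1 - 1) * ((d : F) - x.1)} where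
  toFun M := ⟨(M.1 0 0, M.1 0 1, M.1 1 0),
    (mul_eq_of_det_eq_of_det_one_sub_eq_zero M.2.1 M.2.2).1⟩
  invFun x :=
    have h : (!![x.1.1, x.1.2.1; x.1.2.2, 1 + d - x.1.1]).det = (d : F) := by
      rw [Matrix.det_fin_two_of, x.2]
      ring
    ⟨Matrix.GeneralLinearGroup.mk'' _ (by rw [h]; exact d.isUnit), h, by
      have hx := x.2
      change (1 - !![x.1.1, x.1.2.1; x.1.2.2, 1 + d - x.1.1]).det = 0
      simp [Matrix.det_fin_two]
      grind⟩
  left_inv M := by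
    have h := (mul_eq_of_det_eq_of_det_one_sub_eq_zero M.2.1 M.2.2).2
    ext i j
    fin_cases i <;> fin_cases j <;>
      simp [Matrix.GeneralLinearGroup.mk'', Matrix.nonsingInvUnit, h]
  right_inv x := by
    simp [Matrix.GeneralLinearGroup.mk'', Matrix.nonsingInvUnit]

variable [Fintype F] [DecidableEq F]

lemma sum_ite_mul_eq (b t : F) :
    (∑ c : F, if b * c = t then 1 else 0) =
      if b = 0 then (if t = 0 then Fintype.card F else 0) else 1 := by
  split_ifs with hb ht
  · simp [hb, ht]
  · simp [hb, Ne.symm ht]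
  · have h (c : F) : b * c = t ↔ c = b⁻¹ * t := by
      rw [eq_inv_mul_iff_mul_eq₀ hb]
    simp [h]

lemma sum_sum_ite_mul_eq (t : F) :
    (∑ b : F, ∑ c : F, if b * c = t then 1 else 0) =
      (Fintype.card F - 1) + if t = 0 then Fintype.card F else 0 := by
  simp_rw [sum_ite_mul_eq]
  rw [← Finset.add_sum_erase _ _ (Finset.mem_univ (0 : F)),
    Finset.sum_congr rfl (fun b hb => if_neg (Finset.ne_of_mem_erase hb))]
  simp [Finset.card_erase_of_mem, add_comm]

lemma card_filter_sub_one_mul_sub_eq_zero (d : F) :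
    (Finset.univ.filter fun a : F => (a - 1) * (d - a) = 0).card = if d = 1 then 1 else 2 := by
  have h : (Finset.univ.filter fun a : F => (a - 1) * (d - a) = 0) = {1, d} := by
    ext a
    simp [sub_eq_zero, eq_comm (a := d)]
  rw [h]
  split_ifs with hd
  · simp [hd]
  · exact Finset.card_pair (Ne.symm hd)

lemma card_mul_eq_sub_one_mul_sub (d : F) :
    Nat.card {x : F × F × F // x.2.1 * x.2.2 = (x.1 - 1) * (d - x.1)} =
      if d = 1 then Fintype.card F ^ 2 else Fintype.card F * (Fintype.card F + 1) := by
  rw [Nat.card_eq_fintype_card, Fintype.card_subtype, Finset.card_filter, Fintype.sum_prod_type]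
  simp_rw [Fintype.sum_prod_type, sum_sum_ite_mul_eq]
  rw [Finset.sum_add_distrib, ← Finset.sum_filter, Finset.sum_const, Finset.sum_const,
    card_filter_sub_one_mul_sub_eq_zero, Finset.card_univ]
  obtain ⟨q, hq⟩ : ∃ q, Fintype.card F = q + 1 :=
    Nat.exists_eq_succ_of_ne_zero Fintype.card_ne_zero
  rw [hq]
  split_ifs <;> simp <;> ring

end FiniteField

/-- Partition of `Bset n` according to the common determinant. -/
def bsetEquiv (n : ℕ) : Bset n ≃ Σ d : (ZMod n)ˣ,
    {M : GL (Fin 2) (ZMod n) // (M : Matrix (Fin 2) (Fin 2) (ZMod n)).det = d ∧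
      (1 - (M : Matrix (Fin 2) (Fin 2) (ZMod n))).det = 0} ×
    {M : GL (Fin 2) (ZMod n) // (M : Matrix (Fin 2) (Fin 2) (ZMod n)).det = d ∧
      (1 - (M : Matrix (Fin 2) (Fin 2) (ZMod n))).det = 0} where
  toFun P := ⟨Matrix.GeneralLinearGroup.det P.1.1,
    ⟨P.1.1, rfl, P.2.2.1⟩, ⟨P.1.2, P.2.1.symm, P.2.2.2⟩⟩
  invFun x := ⟨(x.2.1.1, x.2.2.1), x.2.1.2.1.trans x.2.2.2.1.symm, x.2.1.2.2, x.2.2.2.2⟩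
  left_inv _ := rfl
  right_inv := by
    rintro ⟨d, ⟨M, hM, hM'⟩, ⟨N, hN, hN'⟩⟩
    obtain rfl : Matrix.GeneralLinearGroup.det M = d := Units.ext hM
    rfl

/-- For a prime `ℓ`, `|𝓑_ℓ| = ℓ²(ℓ + 2)(ℓ² − ℓ − 1)`. -/
theorem card_Bset (ℓ : ℕ) (hℓ : ℓ.Prime) :
    Nat.card (Bset ℓ) = ℓ ^ 2 * (ℓ + 2) * (ℓ ^ 2 - ℓ - 1) := by
  have : Fact ℓ.Prime := ⟨hℓ⟩
  rw [Nat.card_congr (bsetEquiv ℓ), Nat.card_sigma]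
  simp_rw [Nat.card_prod, Nat.card_congr (eigenvalueOneEquiv _), card_mul_eq_sub_one_mul_sub,
    ZMod.card, Units.val_eq_one]
  rw [← Finset.add_sum_erase _ _ (Finset.mem_univ (1 : (ZMod ℓ)ˣ)),
    Finset.sum_congr rfl (fun d hd => by rw [if_neg (Finset.ne_of_mem_erase hd)]),
    Finset.sum_const, Finset.card_erase_of_mem (Finset.mem_univ _), Finset.card_univ,
    ZMod.card_units, if_pos rfl]
  obtain ⟨k, rfl⟩ := Nat.exists_eq_add_of_le' hℓ.two_le
  have h : (k + 2) ^ 2 - (k + 2) - 1 = k ^ 2 + 3 * k + 1 := by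
    have : (k + 2) ^ 2 = k ^ 2 + 3 * k + 1 + 1 + (k + 2) := by ring
    omega
  rw [h, show k + 2 - 1 - 1 = k by omega, smul_eq_mul]
  ring
end

section
/- Let n be a squarefree positive integer. Then S(n) := Σ_{α ∈ (ℤ/nℤ)ˣ} |X_n^α|² = |Δ(ℤ/nℤ)| · F₁(n). -/
open Matrix

noncomputable section

/-- `F₁(n) = ∏_{primes ℓ ∣ n} (ℓ+2)(ℓ²−ℓ−1)/((ℓ−1)³(ℓ+1)²)`, with `F₁(1) = 1`. -/
def F1 (n : ℕ) : ℚ :=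
  ∏ ℓ ∈ n.primeFactors,
    (((ℓ : ℚ) + 2) * ((ℓ : ℚ) ^ 2 - ℓ - 1)) / (((ℓ : ℚ) - 1) ^ 3 * ((ℓ : ℚ) + 1) ^ 2)

theorem det_one_sub_fin_two {R : Type*} [CommRing R] (M : Matrix (Fin 2) (Fin 2) R) :
    (1 - M).det = 1 - M 0 0 - M 1 1 + M.det := by
  simp only [det_fin_two, Matrix.sub_apply, one_fin_two, of_apply, cons_val', cons_val_zero,
    cons_val_one, cons_val_fin_one]
  ring

/-- The number of `2 × 2` matrices over `R` of determinant `α`. -/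
def detCard (R : Type*) [CommRing R] (α : R) : ℕ :=
  Nat.card {M : Matrix (Fin 2) (Fin 2) R // M.det = α}

/-- The number of `2 × 2` matrices over `R` of determinant `α` with `det (1 - M) = 0`. -/
def fixCard (R : Type*) [CommRing R] (α : R) : ℕ :=
  Nat.card {M : Matrix (Fin 2) (Fin 2) R // (1 - M).det = 0 ∧ M.det = α}

theorem card_Xset (n : ℕ) (α : (ZMod n)ˣ) : Nat.card (Xset n α) = fixCard (ZMod n) α := by
  refine Nat.card_congr
    { toFun := fun M => ⟨M.1, M.2⟩
      invFun := fun M => ⟨GeneralLinearGroup.mk'' M.1 (by rw [M.2.2]; exact α.isUnit), M.2⟩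
      left_inv := fun M => Subtype.ext (Units.ext rfl)
      right_inv := fun M => rfl }

theorem card_DeltaPairs (n : ℕ) [NeZero n] :
    Nat.card (DeltaPairs n) = ∑ α : (ZMod n)ˣ, detCard (ZMod n) α ^ 2 := by
  have e : DeltaPairs n ≃ Σ α : (ZMod n)ˣ,
      {M : Matrix (Fin 2) (Fin 2) (ZMod n) // M.det = α} ×
        {M : Matrix (Fin 2) (Fin 2) (ZMod n) // M.det = α} :=
    { toFun := fun P => ⟨GeneralLinearGroup.det P.1.1, ⟨P.1.1, rfl⟩, ⟨P.1.2, P.2.symm⟩⟩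
      invFun := fun Q => ⟨(GeneralLinearGroup.mk'' Q.2.1.1 (by rw [Q.2.1.2]; exact Q.1.isUnit),
        GeneralLinearGroup.mk'' Q.2.2.1 (by rw [Q.2.2.2]; exact Q.1.isUnit)), Q.2.1.2.trans Q.2.2.2.symm⟩
      left_inv := fun P => Subtype.ext (Prod.ext (Units.ext rfl) (Units.ext rfl))
      right_inv := by
        rintro ⟨α, ⟨M, hM⟩, ⟨N, hN⟩⟩
        have h : GeneralLinearGroup.det
            (GeneralLinearGroup.mk'' M (by rw [hM]; exact α.isUnit)) = α := Units.ext hM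
        have key : ∀ {β : (ZMod n)ˣ} (_ : β = α) (h₁ : M.det = β) (h₂ : N.det = β),
            (⟨β, ⟨M, h₁⟩, ⟨N, h₂⟩⟩ : Σ α : (ZMod n)ˣ,
              {M : Matrix (Fin 2) (Fin 2) (ZMod n) // M.det = α} ×
                {M : Matrix (Fin 2) (Fin 2) (ZMod n) // M.det = α}) =
              ⟨α, ⟨M, hM⟩, ⟨N, hN⟩⟩ := by
          rintro _ rfl _ _
          rfl
        exact key h _ _ }
  rw [Nat.card_congr e, Nat.card_sigma]
  simp [detCard, sq]

section Product

variable {T R S : Type*} [CommRing T] [CommRing R] [CommRing S]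

/-- Matrices over a product of two rings are pairs of matrices over the factors. -/
def matrixProdEquiv (e : T ≃+* R × S) :
    Matrix (Fin 2) (Fin 2) T ≃ Matrix (Fin 2) (Fin 2) R × Matrix (Fin 2) (Fin 2) S where
  toFun M := (M.map fun x => (e x).1, M.map fun x => (e x).2)
  invFun P := Matrix.of fun i j => e.symm (P.1 i j, P.2 i j)
  left_inv M := by ext; simp
  right_inv P := by ext <;> simp

theorem det_matrixProdEquiv (e : T ≃+* R × S) (M : Matrix (Fin 2) (Fin 2) T) :
    ((matrixProdEquiv e M).1.det, (matrixProdEquiv e M).2.det) = e M.det := by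
  ext <;> simp [matrixProdEquiv, det_fin_two]

theorem matrixProdEquiv_one_sub (e : T ≃+* R × S) (M : Matrix (Fin 2) (Fin 2) T) :
    matrixProdEquiv e (1 - M) = 1 - matrixProdEquiv e M := by
  ext i j <;> fin_cases i <;> fin_cases j <;> simp [matrixProdEquiv]

theorem det_eq_iff_matrixProdEquiv (e : T ≃+* R × S) (M : Matrix (Fin 2) (Fin 2) T) (α : T) :
    M.det = α ↔
      (matrixProdEquiv e M).1.det = (e α).1 ∧ (matrixProdEquiv e M).2.det = (e α).2 := by
  rw [← e.injective.eq_iff, ← det_matrixProdEquiv, Prod.ext_iff]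

theorem detCard_prod (e : T ≃+* R × S) (α : T) :
    detCard T α = detCard R (e α).1 * detCard S (e α).2 := by
  unfold detCard
  rw [← Nat.card_prod]
  exact Nat.card_congr (((matrixProdEquiv e).subtypeEquiv fun M =>
    det_eq_iff_matrixProdEquiv e M α).trans
      (Equiv.subtypeProdEquivProd (p := fun M : Matrix (Fin 2) (Fin 2) R => M.det = (e α).1)
        (q := fun M : Matrix (Fin 2) (Fin 2) S => M.det = (e α).2)))

theorem fixCard_prod (e : T ≃+* R × S) (α : T) :
    fixCard T α = fixCard R (e α).1 * fixCard S (e α).2 := by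
  unfold fixCard
  rw [← Nat.card_prod]
  refine Nat.card_congr (((matrixProdEquiv e).subtypeEquiv fun M => ?_).trans
    (Equiv.subtypeProdEquivProd
      (p := fun M : Matrix (Fin 2) (Fin 2) R => (1 - M).det = 0 ∧ M.det = (e α).1)
      (q := fun M : Matrix (Fin 2) (Fin 2) S => (1 - M).det = 0 ∧ M.det = (e α).2)))
  rw [det_eq_iff_matrixProdEquiv e M, det_eq_iff_matrixProdEquiv e (1 - M),
    matrixProdEquiv_one_sub, map_zero]
  exact and_and_and_comm

theorem sum_units_prod [Fintype Tˣ] [Fintype Rˣ] [Fintype Sˣ] (e : T ≃+* R × S)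
    (f : T → ℕ) (g : R → ℕ) (h : S → ℕ) (hf : ∀ x, f x = g (e x).1 * h (e x).2) :
    ∑ α : Tˣ, f α ^ 2 = (∑ α : Rˣ, g α ^ 2) * ∑ α : Sˣ, h α ^ 2 := by
  rw [Fintype.sum_mul_sum, ← Fintype.sum_prod_type']
  refine Fintype.sum_equiv
    ((Units.mapEquiv e.toMulEquiv).trans MulEquiv.prodUnits).toEquiv _ _ fun α => ?_
  rw [hf, mul_pow]
  rfl

end Product

section Field

variable {F : Type*} [Field F] [Fintype F] [DecidableEq F]

theorem card_mul_eq (t : F) :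
    (Nat.card {p : F × F // p.1 * p.2 = t} : ℤ) =
      (Fintype.card F - 1) + if t = 0 then (Fintype.card F : ℤ) else 0 := by
  have e : {p : F × F // p.1 * p.2 = t} ≃ Σ x : F, {y : F // x * y = t} :=
    { toFun := fun p => ⟨p.1.1, p.1.2, p.2⟩
      invFun := fun q => ⟨(q.1, q.2.1), q.2.2⟩
      left_inv := fun _ => rfl
      right_inv := fun _ => rfl }
  have h0 : Nat.card {y : F // 0 * y = t} = if t = 0 then Fintype.card F else 0 := by
    split_ifs with h
    · simp [h]
    · simp [Ne.symm h]
  have h1 : ∀ x ∈ Finset.univ.erase (0 : F), Nat.card {y : F // x * y = t} = 1 := by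
    intro x hx
    have hx : x ≠ 0 := by simpa using hx
    have : ∀ y, x * y = t ↔ y = x⁻¹ * t := fun y => by
      rw [eq_inv_mul_iff_mul_eq₀ hx]
    simp [this]
  rw [Nat.card_congr e, Nat.card_sigma, ← Finset.add_sum_erase _ _ (Finset.mem_univ (0 : F)),
    Finset.sum_congr rfl h1, h0]
  have := Fintype.card_pos (α := F)
  simp [Finset.card_erase_of_mem, Nat.cast_sub (Nat.succ_le_of_lt this)]
  ring

theorem detCard_field {α : F} (hα : α ≠ 0) :
    (detCard F α : ℤ) =
      Fintype.card F * (Fintype.card F - 1) * (Fintype.card F + 1) := by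
  have e : {M : Matrix (Fin 2) (Fin 2) F // M.det = α} ≃
      Σ q : F × F, {p : F × F // p.1 * p.2 = α + q.1 * q.2} :=
    { toFun := fun M => ⟨(M.1 0 1, M.1 1 0), (M.1 0 0, M.1 1 1), by
        have := M.2; rw [det_fin_two] at this; simp [← this]⟩
      invFun := fun Q => ⟨!![Q.2.1.1, Q.1.1; Q.1.2, Q.2.1.2], by
        have := Q.2.2; simp [det_fin_two, this]⟩
      left_inv := fun M => Subtype.ext (eta_fin_two M.1).symm
      right_inv := fun _ => rfl }
  have h : (Nat.card {q : F × F // q.1 * q.2 = -α} : ℤ) = Fintype.card F - 1 := by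
    rw [card_mul_eq, if_neg (neg_ne_zero.mpr hα), add_zero]
  rw [Nat.card_eq_fintype_card, Fintype.card_subtype] at h
  rw [detCard, Nat.card_congr e, Nat.card_sigma]
  push_cast
  simp_rw [card_mul_eq, Finset.sum_add_distrib, ← Finset.sum_filter, add_comm α,
    add_eq_zero_iff_eq_neg, Finset.sum_const, nsmul_eq_mul, h, Finset.card_univ, Fintype.card_prod]
  push_cast
  ring

theorem fixCard_field (α : F) :
    (fixCard F α : ℤ) =
      if α = 1 then (Fintype.card F : ℤ) ^ 2 else Fintype.card F * (Fintype.card F + 1) := by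
  have e : {M : Matrix (Fin 2) (Fin 2) F // (1 - M).det = 0 ∧ M.det = α} ≃
      Σ a : F, {p : F × F // p.1 * p.2 = (a - 1) * (α - a)} :=
    { toFun := fun M => ⟨M.1 0 0, (M.1 0 1, M.1 1 0), by
        obtain ⟨h1, h2⟩ := M.2
        rw [det_one_sub_fin_two, h2] at h1
        rw [det_fin_two] at h2
        linear_combination -h2 - M.1 0 0 * h1⟩
      invFun := fun Q => ⟨!![Q.1, Q.2.1.1; Q.2.1.2, 1 + α - Q.1], by
        have h : det !![Q.1, Q.2.1.1; Q.2.1.2, 1 + α - Q.1] = α := by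
          rw [det_fin_two_of]
          linear_combination -Q.2.2
        refine ⟨?_, h⟩
        rw [det_one_sub_fin_two, h]
        simp⟩
      left_inv := fun M => by
        obtain ⟨h1, h2⟩ := M.2
        rw [det_one_sub_fin_two, h2] at h1
        have : 1 + α - M.1 0 0 = M.1 1 1 := by linear_combination h1
        refine Subtype.ext ?_
        simp only [this]
        exact (eta_fin_two M.1).symm
      right_inv := fun _ => rfl }
  have h : (Finset.univ.filter fun a : F => (a - 1) * (α - a) = 0) = {1, α} := by
    ext a
    simp [sub_eq_zero, eq_comm (a := α)]
  rw [fixCard, Nat.card_congr e, Nat.card_sigma]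
  push_cast
  simp_rw [card_mul_eq, Finset.sum_add_distrib, ← Finset.sum_filter, h, Finset.sum_const,
    nsmul_eq_mul, Finset.card_univ]
  split_ifs with hα
  · simp [hα]
    ring
  · rw [Finset.card_pair (Ne.symm hα)]
    push_cast
    ring

end Field

theorem sum_fixCard_sq_prime (p : ℕ) [Fact p.Prime] :
    ∑ α : (ZMod p)ˣ, (fixCard (ZMod p) α : ℚ) ^ 2 =
      p ^ 2 * ((p + 2) * (p ^ 2 - p - 1)) := by
  have hp : 1 ≤ p := (Fact.out : p.Prime).one_le
  have h (α : (ZMod p)ˣ) : (fixCard (ZMod p) α : ℚ) =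
      if α = 1 then (p : ℚ) ^ 2 else p * (p + 1) := by
    have := fixCard_field (α : ZMod p)
    rw [ZMod.card] at this
    simp only [Units.val_eq_one] at this
    exact_mod_cast this
  rw [← Finset.add_sum_erase _ _ (Finset.mem_univ (1 : (ZMod p)ˣ)),
    Finset.sum_congr rfl fun α hα => by rw [h α, if_neg (Finset.ne_of_mem_erase hα)], h 1,
    if_pos rfl, Finset.sum_const, Finset.card_erase_of_mem (Finset.mem_univ _), Finset.card_univ,
    ZMod.card_units, nsmul_eq_mul]
  have hp2 : 1 ≤ p - 1 := Nat.le_sub_one_of_lt (Fact.out : p.Prime).one_lt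
  push_cast [hp, hp2]
  ring

theorem sum_detCard_sq_prime (p : ℕ) [Fact p.Prime] :
    ∑ α : (ZMod p)ˣ, (detCard (ZMod p) α : ℚ) ^ 2 =
      p ^ 2 * ((p - 1) ^ 3 * (p + 1) ^ 2) := by
  have hp : 1 ≤ p := (Fact.out : p.Prime).one_le
  have h (α : (ZMod p)ˣ) : (detCard (ZMod p) α : ℚ) = p * (p - 1) * (p + 1) := by
    have := detCard_field α.ne_zero
    rw [ZMod.card] at this
    exact_mod_cast this
  simp_rw [h, Finset.sum_const, Finset.card_univ, ZMod.card_units, nsmul_eq_mul]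
  push_cast [hp]
  ring

theorem F1_prime {p : ℕ} (hp : p.Prime) :
    F1 p = (((p : ℚ) + 2) * ((p : ℚ) ^ 2 - p - 1)) / (((p : ℚ) - 1) ^ 3 * ((p : ℚ) + 1) ^ 2) := by
  simp [F1, hp.primeFactors]

theorem F1_mul {a b : ℕ} (h : a.Coprime b) : F1 (a * b) = F1 a * F1 b := by
  rw [F1, h.primeFactors_mul, Finset.prod_union h.disjoint_primeFactors, F1, F1]

theorem sum_fixCard_sq (n : ℕ) [NeZero n] (hsf : Squarefree n) :
    ∑ α : (ZMod n)ˣ, (fixCard (ZMod n) α : ℚ) ^ 2 =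
      (∑ α : (ZMod n)ˣ, (detCard (ZMod n) α : ℚ) ^ 2) * F1 n := by
  revert hsf
  rename_i hn
  revert hn
  induction n using Nat.recOnPosPrimePosCoprime with
  | zero => intro hn; exact absurd rfl hn.ne
  | one =>
    intro _ _
    have : ∀ f : Matrix (Fin 2) (Fin 2) (ZMod 1) → Prop, (∀ M, f M) → Nat.card {M // f M} = 1 :=
      fun f hf => by simp [hf]
    have h1 (α : ZMod 1) : fixCard (ZMod 1) α = 1 :=
      this _ fun M => ⟨Subsingleton.elim _ _, Subsingleton.elim _ _⟩
    have h2 (α : ZMod 1) : detCard (ZMod 1) α = 1 := this _ fun M => Subsingleton.elim _ _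
    simp [h1, h2, F1]
  | prime_pow p k hp hk =>
    intro _ hsf
    obtain rfl : k = 1 := ((Nat.squarefree_pow_iff hp.ne_one hk.ne').mp hsf).2
    generalize hq : p ^ 1 = q at *
    obtain rfl : p = q := (pow_one p).symm.trans hq
    have : Fact p.Prime := ⟨hp⟩
    have h1 : (1 : ℚ) < p := by exact_mod_cast hp.one_lt
    have h2 : (p : ℚ) - 1 ≠ 0 := by linarith
    have h3 : (p : ℚ) + 1 ≠ 0 := by linarith
    rw [F1_prime hp, sum_detCard_sq_prime, sum_fixCard_sq_prime]
    field_simp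
  | coprime a b ha hb hab iha ihb =>
    intro _ hsf
    have : NeZero a := ⟨by lia⟩
    have : NeZero b := ⟨by lia⟩
    have e := ZMod.chineseRemainder hab
    have h1 := sum_units_prod e _ _ _ (fixCard_prod e)
    have h2 := sum_units_prod e _ _ _ (detCard_prod e)
    have ha := iha hsf.of_mul_left
    have hb := ihb hsf.of_mul_right
    rw [F1_mul hab]
    have h1' := congrArg (Nat.cast : ℕ → ℚ) h1
    have h2' := congrArg (Nat.cast : ℕ → ℚ) h2
    push_cast at h1' h2'
    rw [h1', h2', ha, hb]
    ring

/-- For a squarefree positive integer `n`,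
`S(n) = ∑_{α ∈ (ℤ/nℤ)ˣ} |X_n^α|² = |Δ(ℤ/nℤ)| ⬝ F₁(n)`. -/
theorem sum_card_Xset_sq (n : ℕ) [NeZero n] (hsf : Squarefree n) :
    ∑ α : (ZMod n)ˣ, (Nat.card (Xset n α) : ℚ) ^ 2 =
      (Nat.card (DeltaPairs n) : ℚ) * F1 n := by
  have h := sum_fixCard_sq n hsf
  simp_rw [card_Xset, card_DeltaPairs]
  exact_mod_cast h

end
end

section
/- Let M be a squarefree positive integer and let m₁ and m₂ be even divisors of M with lcm(m₁, m₂) = M. Set m = gcd(m₁, m₂) and m' = M/m. Then Σ_{α ∈ (ℤ/Mℤ)ˣ} (1/2 − (1/4)·(a_α / m₁,odd)) · (1/2 − (1/4)·(a_α / m₂,odd)) · |X_M^α|² = (1/4)·|Δ(ℤ/Mℤ)|·F₁(M)·(1 + (2/5)·F₂(m₁)/F₁(m₁) + (2/5)·F₂(m₂)/F₁(m₂) + (1/4)·F₂(m')/F₁(m')), where a_α ∈ ℤ is any integer reducing to α modulo M, m_{i,odd} is the odd part of m_i, and (· / ·) denotes the Jacobi symbol. -/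
open Matrix

noncomputable section

/-- `F₂(n) = ∏_{primes ℓ ∣ n} (−(2ℓ+1))/((ℓ−1)³(ℓ+1)²)`, with `F₂(1) = 1`. -/
def F2 (n : ℕ) : ℚ :=
  ∏ ℓ ∈ n.primeFactors,
    (-(2 * (ℓ : ℚ) + 1)) / (((ℓ : ℚ) - 1) ^ 3 * ((ℓ : ℚ) + 1) ^ 2)

theorem natCard_matrix_of_ringEquiv_prod {n R S T : Type*} [Semiring R] [Semiring S] [Semiring T]
    (e : R ≃+* S × T) {P : Matrix n n R → Prop} {Q : Matrix n n S → Prop}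
    {Q' : Matrix n n T → Prop}
    (h : ∀ A, P A ↔ Q (A.map fun x ↦ (e x).1) ∧ Q' (A.map fun x ↦ (e x).2)) :
    Nat.card {A // P A} = Nat.card {B // Q B} * Nat.card {C // Q' C} := by
  let E : Matrix n n R ≃ Matrix n n S × Matrix n n T :=
    { toFun A := (A.map fun x ↦ (e x).1, A.map fun x ↦ (e x).2)
      invFun B := Matrix.of fun i j ↦ e.symm (B.1 i j, B.2 i j)
      left_inv A := by ext; simp
      right_inv B := by ext <;> simp }
  rw [← Nat.card_prod]
  exact Nat.card_congr ((E.subtypeEquiv h).trans Equiv.subtypeProdEquivProd)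

theorem ringEquiv_prod_det {R S T : Type*} [CommRing R] [CommRing S] [CommRing T]
    (e : R ≃+* S × T) (A : Matrix (Fin 2) (Fin 2) R) :
    e A.det = ((A.map fun x ↦ (e x).1).det, (A.map fun x ↦ (e x).2).det) := by
  ext <;> simp [det_fin_two]

/-- The number of `2 × 2` matrices with determinant `x`. -/
def detCount (R : Type*) [CommRing R] (x : R) : ℕ :=
  Nat.card {A : Matrix (Fin 2) (Fin 2) R // A.det = x}

/-- The number of `2 × 2` matrices with determinant `x` which have `1` as an eigenvalue. -/
def fixCount (R : Type*) [CommRing R] (x : R) : ℕ :=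
  Nat.card {A : Matrix (Fin 2) (Fin 2) R // (1 - A).det = 0 ∧ A.det = x}

theorem detCount_ringEquiv_prod {R S T : Type*} [CommRing R] [CommRing S] [CommRing T]
    (e : R ≃+* S × T) (x : R) :
    detCount R x = detCount S (e x).1 * detCount T (e x).2 := by
  refine natCard_matrix_of_ringEquiv_prod e fun A ↦ ?_
  rw [← e.injective.eq_iff, ringEquiv_prod_det, Prod.ext_iff]

theorem fixCount_ringEquiv_prod {R S T : Type*} [CommRing R] [CommRing S] [CommRing T]
    (e : R ≃+* S × T) (x : R) :
    fixCount R x = fixCount S (e x).1 * fixCount T (e x).2 := by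
  refine natCard_matrix_of_ringEquiv_prod e fun A ↦ ?_
  rw [← e.injective.eq_iff, ← e.injective.eq_iff (a := A.det), ringEquiv_prod_det,
    ringEquiv_prod_det, Prod.ext_iff, Prod.ext_iff]
  have h₁ : (1 - A).map (fun x ↦ (e x).1) = 1 - A.map fun x ↦ (e x).1 := by
    ext i j; fin_cases i <;> fin_cases j <;> simp
  have h₂ : (1 - A).map (fun x ↦ (e x).2) = 1 - A.map fun x ↦ (e x).2 := by
    ext i j; fin_cases i <;> fin_cases j <;> simp
  rw [h₁, h₂, map_zero]
  simp only [Prod.fst_zero, Prod.snd_zero]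
  tauto

theorem jacobiSym_congr {a b : ℤ} {n d : ℕ} (hd : d ∣ n) (h : (a : ZMod n) = b) :
    jacobiSym a d = jacobiSym b d :=
  jacobiSym.mod_left' <|
    ((ZMod.intCast_eq_intCast_iff a b n).1 h).of_dvd (Int.natCast_dvd_natCast.2 hd)

theorem jacobiSym_val_gcd_mul {m n : ℕ} [NeZero m] [NeZero n] (h : m.Coprime n) (d : ℕ)
    (x : ZMod (m * n)) :
    jacobiSym x.val ((m * n).gcd d) =
      jacobiSym (ZMod.chineseRemainder h x).1.val (m.gcd d) *
        jacobiSym (ZMod.chineseRemainder h x).2.val (n.gcd d) := by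
  have hx : ZMod.chineseRemainder h x = ((x.val : ZMod m), (x.val : ZMod n)) := by
    conv_lhs => rw [← ZMod.natCast_zmod_val x, map_natCast]
    rfl
  rw [Nat.gcd_comm, Nat.Coprime.gcd_mul _ h,
    jacobiSym.mul_right' _ (Nat.gcd_ne_zero_right (NeZero.ne m)) (Nat.gcd_ne_zero_right (NeZero.ne n)),
    Nat.gcd_comm d, Nat.gcd_comm d]
  congr 1
  · exact jacobiSym_congr (Nat.gcd_dvd_left m d) (by simp [hx])
  · exact jacobiSym_congr (Nat.gcd_dvd_left n d) (by simp [hx])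

theorem sum_units_mul {A : Type*} [CommSemiring A] {F : ∀ n, ZMod n → A}
    {m n : ℕ} [NeZero m] [NeZero n] (h : m.Coprime n)
    (hF : ∀ x : ZMod (m * n), F (m * n) x =
      F m (ZMod.chineseRemainder h x).1 * F n (ZMod.chineseRemainder h x).2) :
    ∑ x : (ZMod (m * n))ˣ, F (m * n) x = (∑ x : (ZMod m)ˣ, F m x) * ∑ x : (ZMod n)ˣ, F n x := by
  rw [Finset.sum_mul_sum, ← Fintype.sum_prod_type']
  exact Fintype.sum_equiv
    ((Units.mapEquiv (ZMod.chineseRemainder h).toMulEquiv).trans MulEquiv.prodUnits).toEquiv _ _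
    fun x ↦ hF x

theorem sum_units_eq_prod_primeFactors {A : Type*} [CommSemiring A] {F : ∀ n, ZMod n → A}
    (h_one : F 1 1 = 1)
    (hF : ∀ (m n : ℕ) [NeZero m] [NeZero n] (h : m.Coprime n) (x : ZMod (m * n)), F (m * n) x =
      F m (ZMod.chineseRemainder h x).1 * F n (ZMod.chineseRemainder h x).2)
    {S : ℕ → A} (hS : ∀ (p : ℕ) [Fact p.Prime], ∑ x : (ZMod p)ˣ, F p x = S p)
    (n : ℕ) [hn : NeZero n] (hsf : Squarefree n) :
    ∑ x : (ZMod n)ˣ, F n x = ∏ p ∈ n.primeFactors, S p := by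
  induction n using induction_on_primes generalizing hn with
  | zero => simp at hsf
  | one =>
    have : Subsingleton (ZMod 1) := inferInstanceAs (Subsingleton (Fin 1))
    rw [Fintype.sum_subsingleton _ 1]
    simp [h_one]
  | prime_mul p a hp ih =>
    have : Fact p.Prime := ⟨hp⟩
    have : NeZero a := ⟨right_ne_zero_of_mul hsf.ne_zero⟩
    have h : p.Coprime a := Nat.coprime_of_squarefree_mul hsf
    obtain rfl := Subsingleton.elim hn NeZero.mul
    rw [sum_units_mul h (hF p a h), hS, ih hsf.of_mul_right, h.primeFactors_mul,
      Finset.prod_union h.disjoint_primeFactors, hp.primeFactors, Finset.prod_singleton]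

theorem sum_sum_mul_eq {K : Type*} [Field K] [Fintype K] [DecidableEq K] (t : K) :
    ∑ b : K, ∑ c : K, (if b * c = t then 1 else 0 : ℚ) =
      Fintype.card K - 1 + if t = 0 then (Fintype.card K : ℚ) else 0 := by
  have h : ∀ b ∈ Finset.univ.erase (0 : K), ∑ c : K, (if b * c = t then 1 else 0 : ℚ) = 1 := by
    intro b hb
    simp_rw [← eq_inv_mul_iff_mul_eq₀ (Finset.ne_of_mem_erase hb)]
    simp
  rw [← Finset.add_sum_erase _ _ (Finset.mem_univ 0), Finset.sum_congr rfl h]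
  simp [Nat.cast_sub (Fintype.card_pos (α := K)), eq_comm (a := t), add_comm]

theorem natCard_matrix_fin_two {R : Type*} [CommRing R] [Fintype R]
    (P : Matrix (Fin 2) (Fin 2) R → Prop) [DecidablePred P] :
    (Nat.card {A // P A} : ℚ) =
      ∑ a : R, ∑ d : R, ∑ b : R, ∑ c : R, if P !![a, b; c, d] then 1 else 0 := by
  let E : Matrix (Fin 2) (Fin 2) R ≃ R × R × R × R :=
    { toFun A := (A 0 0, A 1 1, A 0 1, A 1 0)
      invFun v := !![v.1, v.2.2.1; v.2.2.2, v.2.1]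
      left_inv A := (eta_fin_two A).symm
      right_inv v := rfl }
  rw [Nat.card_congr (E.subtypeEquiv (q := fun v ↦ P (E.symm v)) (by simp)),
    Nat.card_eq_fintype_card, Fintype.card_subtype, ← Finset.sum_boole]
  simp only [Fintype.sum_prod_type]
  rfl

theorem detCount_field {K : Type*} [Field K] [Fintype K] {x : K} (hx : x ≠ 0) :
    (detCount K x : ℚ) =
      Fintype.card K * (Fintype.card K - 1) * (Fintype.card K + 1) := by
  classical
  have h (a b c d : K) : a * d - b * c = x ↔ b * c = a * d - x := by grind
  simp_rw [detCount, natCard_matrix_fin_two, det_fin_two_of, h, sum_sum_mul_eq, sub_eq_zero,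
    Finset.sum_add_distrib]
  have := sum_sum_mul_eq x
  simp only [if_neg hx] at this
  have h₂ (a d : K) : (if a * d = x then (Fintype.card K : ℚ) else 0) =
      Fintype.card K * if a * d = x then 1 else 0 := by simp
  simp_rw [h₂, ← Finset.mul_sum, this]
  simp
  ring

theorem fixCount_field {K : Type*} [Field K] [Fintype K] [DecidableEq K] (x : K) :
    (fixCount K x : ℚ) =
      Fintype.card K ^ 2 + if x = 1 then 0 else (Fintype.card K : ℚ) := by
  have h (a d b c : K) : ((1 - !![a, b; c, d]).det = 0 ∧ !![a, b; c, d].det = x) ↔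
      d = 1 + x - a ∧ b * c = (a - 1) * (x - a) := by
    simp [det_fin_two]
    grind
  have h0 (a : K) : (a - 1) * (x - a) = 0 ↔ a ∈ ({1, x} : Finset K) := by
    simp [sub_eq_zero, eq_comm (a := x)]
  simp_rw [fixCount, natCard_matrix_fin_two, h, ite_and, Finset.sum_ite_irrel]
  simp only [Finset.sum_const_zero, Finset.sum_ite_eq', Finset.mem_univ, if_true, sum_sum_mul_eq, h0,
    Finset.sum_add_distrib, Finset.sum_ite_mem, Finset.univ_inter, Finset.sum_const, nsmul_eq_mul,
    Finset.card_univ]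
  rcases eq_or_ne x 1 with rfl | hx
  · simp; ring
  · simp [hx, Finset.card_pair hx.symm]; ring

theorem sum_units_jacobiSym {p : ℕ} [Fact p.Prime] (hp : p ≠ 2) :
    ∑ x : (ZMod p)ˣ, jacobiSym (x : ZMod p).val p = 0 := by
  have h : quadraticChar (ZMod p) ≠ 1 := quadraticChar_ne_one (by rwa [ZMod.ringChar_zmod_n])
  have h' : (Units.coeHom ℤ).comp (quadraticChar (ZMod p)).toUnitHom ≠ 1 := by
    contrapose h
    ext x
    simpa using DFunLike.congr_fun h x
  convert sum_hom_units_eq_zero _ h' with x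
  simp [← jacobiSym.legendreSym.to_jacobiSym, legendreSym]

theorem sum_units_detCount_sq {p : ℕ} [Fact p.Prime] :
    ∑ x : (ZMod p)ˣ, (detCount (ZMod p) x : ℚ) ^ 2 = p ^ 2 * (p - 1) ^ 3 * (p + 1) ^ 2 := by
  have h (x : (ZMod p)ˣ) := detCount_field x.ne_zero
  simp_rw [h, ZMod.card, Finset.sum_const, Finset.card_univ,
    ZMod.card_units, nsmul_eq_mul, Nat.cast_pred (Fact.out : p.Prime).pos]
  ring

theorem fixCount_sq {p : ℕ} [Fact p.Prime] (x : (ZMod p)ˣ) :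
    (fixCount (ZMod p) x : ℚ) ^ 2 =
      (p ^ 2 + p) ^ 2 - if x = 1 then (p : ℚ) ^ 2 * (2 * p + 1) else 0 := by
  rw [fixCount_field, ZMod.card]
  simp only [Units.val_eq_one]
  split_ifs <;> ring

theorem sum_units_fixCount_sq {p : ℕ} [Fact p.Prime] :
    ∑ x : (ZMod p)ˣ, (fixCount (ZMod p) x : ℚ) ^ 2 = p ^ 2 * ((p + 2) * (p ^ 2 - p - 1)) := by
  simp_rw [fixCount_sq, Finset.sum_sub_distrib, Finset.sum_ite_eq', Finset.sum_const,
    Finset.card_univ, ZMod.card_units, nsmul_eq_mul, Nat.cast_pred (Fact.out : p.Prime).pos]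
  simp
  ring

theorem sum_units_jacobiSym_mul_fixCount_sq {p : ℕ} [Fact p.Prime] (hp : p ≠ 2) :
    ∑ x : (ZMod p)ˣ, (jacobiSym (x : ZMod p).val p : ℚ) * (fixCount (ZMod p) x : ℚ) ^ 2 =
      p ^ 2 * -(2 * p + 1) := by
  have : Fact (1 < p) := ⟨(Fact.out : p.Prime).one_lt⟩
  simp_rw [fixCount_sq, mul_sub, Finset.sum_sub_distrib, ← Finset.sum_mul, ← Int.cast_sum,
    sum_units_jacobiSym hp, mul_ite, mul_zero, Finset.sum_ite_eq']
  simp [ZMod.val_one, jacobiSym.one_left]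
  ring

theorem natCard_Xset {n : ℕ} (α : (ZMod n)ˣ) : Nat.card (Xset n α) = fixCount (ZMod n) α :=
  Nat.card_congr
    { toFun A := ⟨A.1, A.2⟩
      invFun A := ⟨GeneralLinearGroup.mk'' A.1 (by rw [A.2.2]; exact α.isUnit), A.2⟩
      left_inv A := by ext; rfl
      right_inv A := rfl }

theorem natCard_DeltaPairs (n : ℕ) [NeZero n] :
    Nat.card (DeltaPairs n) = ∑ α : (ZMod n)ˣ, detCount (ZMod n) α ^ 2 := by
  let E (α : (ZMod n)ˣ) :
      {P : DeltaPairs n // GeneralLinearGroup.det P.1.1 = α} ≃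
      {A : Matrix (Fin 2) (Fin 2) (ZMod n) // A.det = α} ×
        {A : Matrix (Fin 2) (Fin 2) (ZMod n) // A.det = α} :=
    { toFun P := ⟨⟨P.1.1.1, congrArg Units.val P.2⟩,
        ⟨P.1.1.2, P.1.2.symm.trans (congrArg Units.val P.2)⟩⟩
      invFun Q := ⟨⟨(GeneralLinearGroup.mk'' Q.1.1 (by rw [Q.1.2]; exact α.isUnit),
        GeneralLinearGroup.mk'' Q.2.1 (by rw [Q.2.2]; exact α.isUnit)),
          Q.1.2.trans Q.2.2.symm⟩, Units.ext Q.1.2⟩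
      left_inv P := by ext <;> rfl
      right_inv Q := rfl }
  rw [← Nat.card_congr (Equiv.sigmaFiberEquiv fun P : DeltaPairs n ↦ GeneralLinearGroup.det P.1.1),
    Nat.card_sigma]
  simp_rw [Nat.card_congr (E _), Nat.card_prod, ← sq]
  rfl

theorem detCount_of_subsingleton {R : Type*} [CommRing R] [Subsingleton R] (x : R) :
    detCount R x = 1 :=
  Nat.card_eq_one_iff_unique.2 ⟨inferInstance, ⟨0, Subsingleton.elim _ _⟩⟩

theorem fixCount_of_subsingleton {R : Type*} [CommRing R] [Subsingleton R] (x : R) :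
    fixCount R x = 1 :=
  Nat.card_eq_one_iff_unique.2 ⟨inferInstance, ⟨0, Subsingleton.elim _ _, Subsingleton.elim _ _⟩⟩

theorem natCard_DeltaPairs_of_squarefree {n : ℕ} [NeZero n] (hn : Squarefree n) :
    (Nat.card (DeltaPairs n) : ℚ) =
      ∏ p ∈ n.primeFactors, ((p : ℚ) ^ 2 * (p - 1) ^ 3 * (p + 1) ^ 2) := by
  rw [natCard_DeltaPairs]
  push_cast
  refine sum_units_eq_prod_primeFactors (F := fun n x ↦ (detCount (ZMod n) x : ℚ) ^ 2)
    ?_ (fun m n _ _ h x ↦ ?_) (fun p _ ↦ sum_units_detCount_sq) n hn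
  · have : Subsingleton (ZMod 1) := inferInstanceAs (Subsingleton (Fin 1))
    simp [detCount_of_subsingleton]
  · simp only [detCount_ringEquiv_prod (ZMod.chineseRemainder h) x, Nat.cast_mul, mul_pow]

theorem sum_jacobiSym_mul_fixCount_sq {n d : ℕ} [NeZero n] (hn : Squarefree n) (hdn : d ∣ n)
    (hd : Odd d) :
    ∑ x : (ZMod n)ˣ, (jacobiSym (x : ZMod n).val d : ℚ) * (fixCount (ZMod n) x : ℚ) ^ 2 =
      ∏ p ∈ n.primeFactors, if p ∣ d then (p : ℚ) ^ 2 * -(2 * p + 1)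
        else (p : ℚ) ^ 2 * ((p + 2) * (p ^ 2 - p - 1)) := by
  have key := sum_units_eq_prod_primeFactors
    (F := fun n x ↦ (jacobiSym x.val (n.gcd d) : ℚ) * (fixCount (ZMod n) x : ℚ) ^ 2)
    (S := fun p ↦ if p ∣ d then (p : ℚ) ^ 2 * -(2 * p + 1)
        else p ^ 2 * ((p + 2) * (p ^ 2 - p - 1))) ?_ (fun m n _ _ h x ↦ ?_) (fun p hp ↦ ?_) n hn
  · simpa only [Nat.gcd_eq_right hdn] using key
  · have : Subsingleton (ZMod 1) := inferInstanceAs (Subsingleton (Fin 1))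
    simp [fixCount_of_subsingleton]
  · simp only [fixCount_ringEquiv_prod (ZMod.chineseRemainder h) x, jacobiSym_val_gcd_mul h]
    push_cast
    ring
  · split_ifs with hpd
    · simp only [Nat.gcd_eq_left hpd]
      exact sum_units_jacobiSym_mul_fixCount_sq fun h ↦ hd.not_two_dvd_nat (h ▸ hpd)
    · simp only [(Nat.Prime.coprime_iff_not_dvd hp.out).2 hpd |>.gcd_eq_one]
      simpa using sum_units_fixCount_sq

theorem F2_div_F1_eq_prod {n d : ℕ} (hn : n ≠ 0) (hdn : d ∣ n) :
    F2 d / F1 d = ∏ p ∈ n.primeFactors, if p ∣ d then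
      (-(2 * p + 1) : ℚ) / ((p + 2) * (p ^ 2 - p - 1)) else 1 := by
  rw [F1, F2, ← Finset.prod_div_distrib, ← Finset.prod_filter]
  have hd : n.primeFactors.filter (· ∣ d) = d.primeFactors := by
    ext p
    simp only [Finset.mem_filter, Nat.mem_primeFactors]
    exact ⟨fun h ↦ ⟨h.1.1, h.2, ne_zero_of_dvd_ne_zero hn hdn⟩,
      fun h ↦ ⟨⟨h.1, h.2.1.trans hdn, hn⟩, h.2.1⟩⟩
  rw [hd]
  refine Finset.prod_congr rfl fun p hp ↦ ?_
  have hp : (2 : ℚ) ≤ p := mod_cast (Nat.prime_of_mem_primeFactors hp).two_le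
  refine div_div_div_cancel_right₀ ?_ _ _
  have : (p : ℚ) - 1 ≠ 0 := by linarith
  positivity

theorem sum_jacobiSym_mul_natCard_Xset_sq {n d : ℕ} [NeZero n] (hn : Squarefree n) (hdn : d ∣ n)
    (hd : Odd d) (a : (ZMod n)ˣ → ℤ) (ha : ∀ α : (ZMod n)ˣ, (a α : ZMod n) = (α : ZMod n)) :
    ∑ α : (ZMod n)ˣ, (jacobiSym (a α) d : ℚ) * (Nat.card (Xset n α) : ℚ) ^ 2 =
      Nat.card (DeltaPairs n) * F1 n * (F2 d / F1 d) := by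
  have h (α : (ZMod n)ˣ) : jacobiSym (a α) d = jacobiSym (α : ZMod n).val d :=
    jacobiSym_congr hdn (by simp [ha])
  simp_rw [h, natCard_Xset]
  rw [sum_jacobiSym_mul_fixCount_sq hn hdn hd, natCard_DeltaPairs_of_squarefree hn,
    F2_div_F1_eq_prod hn.ne_zero hdn, F1, ← Finset.prod_mul_distrib, ← Finset.prod_mul_distrib]
  refine Finset.prod_congr rfl fun p hp ↦ ?_
  have hp : (2 : ℚ) ≤ p := mod_cast (Nat.prime_of_mem_primeFactors hp).two_le
  have h₁ : (p : ℚ) - 1 ≠ 0 := by linarith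
  have h₂ : (p : ℚ) * (p - 1) - 1 ≠ 0 := by nlinarith
  rw [show (p : ℚ) ^ 2 - p - 1 = p * (p - 1) - 1 by ring]
  split_ifs <;> field_simp

theorem F2_div_F1_two_mul {d : ℕ} (hd : Odd d) :
    F2 (2 * d) / F1 (2 * d) = -(5 / 4) * (F2 d / F1 d) := by
  have h : Nat.Coprime 2 d := hd.coprime_two_left
  have h₂ : F1 (2 * d) = 4 / 9 * F1 d := by
    rw [F1, F1, h.primeFactors_mul, Finset.prod_union h.disjoint_primeFactors,
      Nat.prime_two.primeFactors, Finset.prod_singleton]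
    norm_num
  have h₃ : F2 (2 * d) = -(5 / 9) * F2 d := by
    rw [F2, F2, h.primeFactors_mul, Finset.prod_union h.disjoint_primeFactors,
      Nat.prime_two.primeFactors, Finset.prod_singleton]
    norm_num
  rw [h₂, h₃, mul_div_mul_comm]
  norm_num

theorem exists_eq_two_mul_odd {n : ℕ} (hn : Squarefree n) (h : 2 ∣ n) :
    ∃ d, n = 2 * d ∧ Odd d := by
  obtain ⟨d, rfl⟩ := h
  exact ⟨d, rfl, (Nat.coprime_of_squarefree_mul hn).odd_of_left⟩

theorem ordCompl_two_mul {d : ℕ} (hd : Odd d) : ordCompl[2] (2 * d) = d := by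
  rw [Nat.factorization_mul two_ne_zero hd.pos.ne']
  simp [Nat.factorization_eq_zero_of_not_dvd hd.not_two_dvd_nat, Nat.prime_two.factorization]

/-- Let `M` be a squarefree positive integer, `m₁, m₂` even divisors
of `M` with `lcm(m₁, m₂) = M`, and set `m = gcd(m₁, m₂)`, `m' = M / m`. Then
`∑_{α ∈ (ℤ/Mℤ)ˣ} (1/2 − (1/4)(a_α / m₁,odd))(1/2 − (1/4)(a_α / m₂,odd)) |X_M^α|²
 = (1/4)|Δ(ℤ/Mℤ)| F₁(M) (1 + (2/5)F₂(m₁)/F₁(m₁) + (2/5)F₂(m₂)/F₁(m₂) + (1/4)F₂(m')/F₁(m'))`,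
where `a_α` is any integer lift of `α` and `(⬝/⬝)` is the Jacobi symbol. -/
theorem sum_quarter_identity (M : ℕ) [NeZero M] (hsf : Squarefree M)
    (m₁ m₂ : ℕ) (h₁ : m₁ ∣ M) (h₂ : m₂ ∣ M) (he₁ : 2 ∣ m₁) (he₂ : 2 ∣ m₂)
    (hlcm : Nat.lcm m₁ m₂ = M)
    (a : (ZMod M)ˣ → ℤ) (ha : ∀ α : (ZMod M)ˣ, ((a α : ZMod M)) = (α : ZMod M)) :
    ∑ α : (ZMod M)ˣ,
        ((1 / 2 : ℚ) - (1 / 4) * (jacobiSym (a α) (ordCompl[2] m₁) : ℚ)) *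
        ((1 / 2 : ℚ) - (1 / 4) * (jacobiSym (a α) (ordCompl[2] m₂) : ℚ)) *
        (Nat.card (Xset M α) : ℚ) ^ 2 =
      (1 / 4) * (Nat.card (DeltaPairs M) : ℚ) * F1 M *
        (1 + (2 / 5) * F2 m₁ / F1 m₁ + (2 / 5) * F2 m₂ / F1 m₂ +
          (1 / 4) * F2 (M / Nat.gcd m₁ m₂) / F1 (M / Nat.gcd m₁ m₂)) := by
  obtain ⟨d₁, rfl, hd₁⟩ := exists_eq_two_mul_odd (hsf.squarefree_of_dvd h₁) he₁
  obtain ⟨d₂, rfl, hd₂⟩ := exists_eq_two_mul_odd (hsf.squarefree_of_dvd h₂) he₂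
  obtain ⟨g, u, v, hg, huv, rfl, rfl⟩ := Nat.exists_coprime'
    (Nat.gcd_pos_of_pos_left d₂ hd₁.pos)
  have hu := Nat.odd_mul.1 hd₁
  have hv := Nat.odd_mul.1 hd₂
  have hgcd : Nat.gcd (2 * (u * g)) (2 * (v * g)) = 2 * g := by
    rw [Nat.gcd_mul_left, Nat.gcd_mul_right, huv.gcd_eq_one, one_mul]
  have hM : M = u * v * (2 * g) := by
    rw [← hlcm, Nat.lcm, hgcd]
    refine Nat.div_eq_of_eq_mul_left (by positivity) (by ring)
  have hdiv : M / (2 * g) = u * v := by rw [hM, Nat.mul_div_cancel _ (by positivity)]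
  have huvM : u * v ∣ M := hM ▸ dvd_mul_right _ _
  have hgM : g ∣ M := hM ▸ Dvd.intro_left (u * v * 2) (by ring)
  rw [hgcd, hdiv, ordCompl_two_mul hd₁, ordCompl_two_mul hd₂, mul_div_assoc, mul_div_assoc,
    mul_div_assoc, F2_div_F1_two_mul hd₁, F2_div_F1_two_mul hd₂]
  have key {d : ℕ} (hdM : d ∣ M) (hd : Odd d) :=
    sum_jacobiSym_mul_natCard_Xset_sq hsf hdM hd a ha
  have hJ (α : (ZMod M)ˣ) : jacobiSym (a α) (u * g) * jacobiSym (a α) (v * g) =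
      jacobiSym (a α) (u * v) := by
    have hα : jacobiSym (a α) g ^ 2 = 1 := by
      refine jacobiSym.sq_one (Int.isCoprime_iff_gcd_eq_one.1 ?_)
      refine IsCoprime.of_isCoprime_of_dvd_right ?_ (Int.natCast_dvd_natCast.2 hgM)
      exact ((ZMod.coe_int_isUnit_iff_isCoprime _ _).1 (ha α ▸ α.isUnit)).symm
    rw [jacobiSym.mul_right' _ hu.1.pos.ne' hg.ne', jacobiSym.mul_right' _ hv.1.pos.ne' hg.ne',
      jacobiSym.mul_right' _ hu.1.pos.ne' hv.1.pos.ne']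
    linear_combination jacobiSym (a α) u * jacobiSym (a α) v * hα
  have hsum (α : (ZMod M)ˣ) :
      ((1 / 2 : ℚ) - (1 / 4) * (jacobiSym (a α) (u * g) : ℚ)) *
        ((1 / 2 : ℚ) - (1 / 4) * (jacobiSym (a α) (v * g) : ℚ)) *
        (Nat.card (Xset M α) : ℚ) ^ 2 =
      1 / 4 * (jacobiSym (a α) 1 * (Nat.card (Xset M α) : ℚ) ^ 2) -
      1 / 8 * (jacobiSym (a α) (u * g) * (Nat.card (Xset M α) : ℚ) ^ 2) -
      1 / 8 * (jacobiSym (a α) (v * g) * (Nat.card (Xset M α) : ℚ) ^ 2) +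
      1 / 16 * (jacobiSym (a α) (u * v) * (Nat.card (Xset M α) : ℚ) ^ 2) := by
    rw [← hJ, jacobiSym.one_right]
    push_cast
    ring
  simp_rw [hsum, Finset.sum_add_distrib, Finset.sum_sub_distrib, ← Finset.mul_sum]
  rw [key (one_dvd M) odd_one, key (dvd_of_mul_left_dvd h₁) hd₁, key (dvd_of_mul_left_dvd h₂) hd₂,
    key huvM (hu.1.mul hv.1)]
  have h_one : F2 1 / F1 1 = 1 := by simp [F1, F2]
  rw [h_one]
  ring

end
end

section
/- Let i ∈ {1, 2}. For any distinct primes p > q and any squarefree positive integer t coprime to p, one has F_i*(p·t) < F_i*(q). -/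
/-- `F₁*(n) = ∏_{primes ℓ ∣ n} (ℓ³+ℓ²−3ℓ−2)/(ℓ⁵−ℓ⁴−3ℓ³+ℓ²+4ℓ+1)`, with `F₁*(1) = 1`. -/
def Fstar1 (n : ℕ) : ℚ :=
  ∏ ℓ ∈ n.primeFactors,
    ((ℓ : ℚ) ^ 3 + (ℓ : ℚ) ^ 2 - 3 * ℓ - 2) /
      ((ℓ : ℚ) ^ 5 - (ℓ : ℚ) ^ 4 - 3 * (ℓ : ℚ) ^ 3 + (ℓ : ℚ) ^ 2 + 4 * ℓ + 1)

/-- `F₂*(n) = ∏_{primes ℓ ∣ n} (2ℓ+1)/(ℓ⁵−ℓ⁴−3ℓ³+ℓ²+4ℓ+1)`, with `F₂*(1) = 1`. -/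
def Fstar2 (n : ℕ) : ℚ :=
  ∏ ℓ ∈ n.primeFactors,
    (2 * (ℓ : ℚ) + 1) /
      ((ℓ : ℚ) ^ 5 - (ℓ : ℚ) ^ 4 - 3 * (ℓ : ℚ) ^ 3 + (ℓ : ℚ) ^ 2 + 4 * ℓ + 1)

theorem prod_primeFactors_mul_lt (f : ℕ → ℚ) (hpos : ∀ n, 2 ≤ n → 0 < f n)
    (hle : ∀ n, 2 ≤ n → f n ≤ 1) (hlt : ∀ m n, 2 ≤ m → m < n → f n < f m)
    {p q t : ℕ} (hp : p.Prime) (hq : q.Prime) (hqp : q < p) (hco : Nat.Coprime t p) :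
    ∏ ℓ ∈ (p * t).primeFactors, f ℓ < ∏ ℓ ∈ q.primeFactors, f ℓ := by
  rw [hco.symm.primeFactors_mul, Finset.prod_union hco.symm.disjoint_primeFactors,
    hp.primeFactors, hq.primeFactors, Finset.prod_singleton, Finset.prod_singleton]
  have ht : ∏ ℓ ∈ t.primeFactors, f ℓ ≤ 1 := Finset.prod_le_one
    (fun ℓ hℓ => (hpos ℓ (Nat.prime_of_mem_primeFactors hℓ).two_le).le)
    (fun ℓ hℓ => hle ℓ (Nat.prime_of_mem_primeFactors hℓ).two_le)
  exact (mul_le_of_le_one_right (hpos p hp.two_le).le ht).trans_lt (hlt q p hq.two_le hqp)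

theorem Fstar_denominator_pos {n : ℕ} (hn : 2 ≤ n) :
    0 < (n : ℚ) ^ 5 - (n : ℚ) ^ 4 - 3 * (n : ℚ) ^ 3 + (n : ℚ) ^ 2 + 4 * n + 1 := by
  obtain ⟨x, rfl⟩ := Nat.exists_eq_add_of_le hn
  push_cast
  ring_nf
  positivity

/-- Let `F` be `F₁*` or `F₂*` (i.e. `i ∈ {1,2}`). For any distinct
primes `p > q` and any squarefree positive integer `t` coprime to `p`, one has
`F(p⬝t) < F(q)`. -/
theorem Fstar_mul_lt (F : ℕ → ℚ) (hF : F = Fstar1 ∨ F = Fstar2)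
    (p q : ℕ) (hp : p.Prime) (hq : q.Prime) (hqp : q < p)
    (t : ℕ) (ht : 0 < t) (htsf : Squarefree t) (hco : Nat.Coprime t p) :
    F (p * t) < F q := by
  rcases hF with rfl | rfl
  · refine prod_primeFactors_mul_lt _ (fun n hn => div_pos ?_ (Fstar_denominator_pos hn))
      (fun n hn => (div_le_one (Fstar_denominator_pos hn)).2 ?_) (fun m n hm hmn => ?_)
      hp hq hqp hco
    · obtain ⟨x, rfl⟩ := Nat.exists_eq_add_of_le hn
      push_cast
      ring_nf
      positivity
    · obtain ⟨x, rfl⟩ := Nat.exists_eq_add_of_le hn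
      rw [← sub_nonneg]
      push_cast
      ring_nf
      positivity
    · rw [div_lt_div_iff₀ (Fstar_denominator_pos (hm.trans hmn.le)) (Fstar_denominator_pos hm)]
      obtain ⟨x, rfl⟩ := Nat.exists_eq_add_of_le hm
      obtain ⟨y, rfl⟩ := Nat.exists_eq_add_of_lt hmn
      rw [← sub_pos]
      push_cast
      ring_nf
      positivity
  · refine prod_primeFactors_mul_lt _
      (fun n hn => div_pos (by positivity) (Fstar_denominator_pos hn))
      (fun n hn => (div_le_one (Fstar_denominator_pos hn)).2 ?_) (fun m n hm hmn => ?_)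
      hp hq hqp hco
    · obtain ⟨x, rfl⟩ := Nat.exists_eq_add_of_le hn
      rw [← sub_nonneg]
      push_cast
      ring_nf
      positivity
    · rw [div_lt_div_iff₀ (Fstar_denominator_pos (hm.trans hmn.le)) (Fstar_denominator_pos hm)]
      obtain ⟨x, rfl⟩ := Nat.exists_eq_add_of_le hm
      obtain ⟨y, rfl⟩ := Nat.exists_eq_add_of_lt hmn
      rw [← sub_pos]
      push_cast
      ring_nf
      positivity
end

section
/- Let i ∈ {1, 2}. For any odd squarefree integer t ≥ 3, one has F_i*(2t) ≤ F_i*(6). -/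
/-- If `f 2 ≥ 0` and `0 ≤ f n ≤ f 3 ≤ 1` for all `n ≥ 3`, then among the products of `f` over the
primes dividing `2 * t` with `t ≥ 3` odd, the one for `t = 3` is the largest. -/
theorem prod_primeFactors_two_mul_le {f : ℕ → ℚ} (h2 : 0 ≤ f 2) (h3 : f 3 ≤ 1)
    (hf : ∀ n, 3 ≤ n → 0 ≤ f n ∧ f n ≤ f 3) {t : ℕ} (ht : 3 ≤ t) (htodd : Odd t) :
    ∏ p ∈ (2 * t).primeFactors, f p ≤ ∏ p ∈ Nat.primeFactors 6, f p := by
  have key (s : ℕ) (hs : Odd s) :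
      ∏ p ∈ (2 * s).primeFactors, f p = f 2 * ∏ p ∈ s.primeFactors, f p := by
    rw [(Nat.coprime_two_left.mpr hs).primeFactors_mul,
      Finset.prod_union (Nat.coprime_two_left.mpr hs).disjoint_primeFactors,
      Nat.prime_two.primeFactors, Finset.prod_singleton]
  have three_le {p : ℕ} (hp : p ∈ t.primeFactors) : 3 ≤ p := by
    have hodd : Odd p := htodd.of_dvd_nat (Nat.dvd_of_mem_primeFactors hp)
    have htwo := (Nat.prime_of_mem_primeFactors hp).two_le
    grind
  rw [key t htodd, show (6 : ℕ) = 2 * 3 from rfl, key 3 (by decide),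
    Nat.prime_three.primeFactors, Finset.prod_singleton]
  refine mul_le_mul_of_nonneg_left ?_ h2
  obtain ⟨q, hq⟩ : t.primeFactors.Nonempty := Nat.nonempty_primeFactors.mpr (by omega)
  rw [← Finset.mul_prod_erase _ _ hq]
  have hq' := hf q (three_le hq)
  refine (mul_le_of_le_one_right hq'.1 (Finset.prod_le_one ?_ ?_)).trans hq'.2
  · exact fun p hp ↦ (hf p (three_le (Finset.mem_of_mem_erase hp))).1
  · exact fun p hp ↦ (hf p (three_le (Finset.mem_of_mem_erase hp))).2.trans h3

/-- Let `F` be `F₁*` or `F₂*` (i.e. `i ∈ {1,2}`). For any odd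
squarefree integer `t ≥ 3`, one has `F(2t) ≤ F(6)`. -/
theorem Fstar_two_mul_le (F : ℕ → ℚ) (hF : F = Fstar1 ∨ F = Fstar2)
    (t : ℕ) (ht : 3 ≤ t) (htodd : Odd t) (htsf : Squarefree t) :
    F (2 * t) ≤ F 6 := by
  rcases hF with rfl | rfl
  all_goals
    refine prod_primeFactors_two_mul_le (by norm_num) (by norm_num) (fun n hn ↦ ?_) ht htodd
    obtain ⟨k, rfl⟩ := Nat.exists_eq_add_of_le hn
    have hk : (0 : ℚ) ≤ k := k.cast_nonneg
    push_cast
    have hden : 0 < (3 + k : ℚ) ^ 5 - (3 + k) ^ 4 - 3 * (3 + k) ^ 3 + (3 + k) ^ 2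
        + 4 * (3 + k) + 1 := by
      ring_nf
      positivity
    constructor
    · refine div_nonneg ?_ hden.le
      ring_nf
      positivity
    · rw [div_le_div_iff₀ hden (by norm_num), ← sub_nonneg]
      ring_nf
      positivity
end

section
/- Let C^coprime = ∏_{ℓ prime} (1 − (ℓ+2)(ℓ²−ℓ−1)/((ℓ−1)³(ℓ+1)²)). Then (1150648/1118065) · C^coprime < 6/π². -/
/-- `F₁(ℓ) = (ℓ+2)(ℓ²−ℓ−1)/((ℓ−1)³(ℓ+1)²)`, as a real number. -/
noncomputable def F1term (ℓ : ℕ) : ℝ :=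
  (((ℓ : ℝ) + 2) * ((ℓ : ℝ) ^ 2 - ℓ - 1)) / (((ℓ : ℝ) - 1) ^ 3 * ((ℓ : ℝ) + 1) ^ 2)

theorem F1term_nonneg {ℓ : ℕ} (hℓ : 2 ≤ ℓ) : 0 ≤ F1term ℓ := by
  obtain ⟨t, rfl⟩ := Nat.exists_eq_add_of_le hℓ
  have ht : (0 : ℝ) ≤ t := t.cast_nonneg
  unfold F1term
  push_cast
  have h1 : (0 : ℝ) ≤ (2 + t) ^ 2 - (2 + t) - 1 := by nlinarith
  have h2 : (0 : ℝ) ≤ 2 + t - 1 := by linarith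
  positivity

theorem F1term_le_two_div_sq {ℓ : ℕ} (hℓ : 2 ≤ ℓ) : F1term ℓ ≤ 2 / (ℓ : ℝ) ^ 2 := by
  obtain ⟨t, rfl⟩ := Nat.exists_eq_add_of_le hℓ
  have ht : (0 : ℝ) ≤ t := t.cast_nonneg
  unfold F1term
  push_cast
  have h2 : (0 : ℝ) < 2 + t - 1 := by linarith
  rw [div_le_div_iff₀ (by positivity) (by positivity), ← sub_nonneg]
  have h : 0 ≤ 1 + (1 - (t : ℝ)) ^ 2 + 7 * t ^ 2 + 15 * t ^ 3 + 7 * t ^ 4 + t ^ 5 := by positivity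
  linarith

theorem one_sub_F1term_mem_Icc {ℓ : ℕ} (hℓ : 2 ≤ ℓ) : 1 - F1term ℓ ∈ Set.Icc (0 : ℝ) 1 := by
  have h0 := F1term_nonneg hℓ
  have h1 := F1term_le_two_div_sq hℓ
  have h2 : (2 : ℝ) ≤ ℓ := by exact_mod_cast hℓ
  have h3 : 2 / (ℓ : ℝ) ^ 2 ≤ 1 := by
    rw [div_le_one (by positivity)]
    nlinarith
  constructor <;> linarith

theorem summable_F1term_primes : Summable fun p : Nat.Primes => F1term p := by
  have h : Summable fun n : ℕ => 2 / (n : ℝ) ^ 2 := by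
    simpa [div_eq_mul_inv] using (Real.summable_nat_pow_inv.mpr one_lt_two).mul_left 2
  exact Summable.of_nonneg_of_le (fun p => F1term_nonneg p.2.two_le)
    (fun p => F1term_le_two_div_sq p.2.two_le) (h.comp_injective Subtype.val_injective)

theorem multipliable_one_sub_F1term_primes :
    Multipliable fun p : Nat.Primes => 1 - F1term p := by
  simpa [sub_eq_add_neg] using
    Real.multipliable_one_add_of_summable summable_F1term_primes.neg

theorem tprod_one_sub_F1term_le (q : Nat.Primes) :
    ∏' p : Nat.Primes, (1 - F1term p) ≤ 1 - F1term q := by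
  refine le_of_tendsto multipliable_one_sub_F1term_primes.hasProd ?_
  filter_upwards [Filter.eventually_ge_atTop {q}] with s hs
  have hmem (p : Nat.Primes) : 1 - F1term p ∈ Set.Icc (0 : ℝ) 1 :=
    one_sub_F1term_mem_Icc p.2.two_le
  rw [← Finset.mul_prod_erase s _ (hs (Finset.mem_singleton_self q))]
  exact mul_le_of_le_one_right (hmem q).1
    (Finset.prod_le_one (fun p _ => (hmem p).1) fun p _ => (hmem p).2)

/-- With `C^coprime = ∏_{ℓ prime} (1 − F₁(ℓ))`, one has
`(1150648/1118065) ⬝ C^coprime < 6/π²`. -/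
theorem serre_pair_upper_bound_lt_six_div_pi_sq :
    (1150648 / 1118065 : ℝ) * (∏' p : Nat.Primes, (1 - F1term p)) <
      6 / Real.pi ^ 2 := by
  have h := tprod_one_sub_F1term_le ⟨2, Nat.prime_two⟩
  have h2 : 1 - F1term 2 = 5 / 9 := by norm_num [F1term]
  have hpi : Real.pi ^ 2 < 10 := by nlinarith [Real.pi_lt_d2, Real.pi_pos]
  have h6 : (6 / 10 : ℝ) < 6 / Real.pi ^ 2 := by
    have := Real.pi_pos
    gcongr
  change _ ≤ 1 - F1term 2 at h
  linarith
end

section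
/- Let m₁ and m₂ be even integers, each at least 6, each with squarefree odd part, and with m₁ ≠ m₂. Then 5014419112/5014521525 ≤ R(m₁, m₂) ≤ 1150648/1118065, where R(70, 210) = 5014419112/5014521525 and R(6, 10) = 1150648/1118065, so both bounds are attained. -/
open ArithmeticFunction in
/-- For even positive integers `m₁, m₂` (with squarefree odd parts), with
`m = gcd(m₁,m₂)` and `m' = lcm(m₁,m₂)/m`, the ratio `R(m₁,m₂)` of
Theorem 5.2 of the paper. -/
noncomputable def Rratio (m₁ m₂ : ℕ) : ℚ :=
  if 4 ∣ m₁ then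
    (if 4 ∣ m₂ then 1 else 1 + (2 / 5) * Fstar2 m₂)
  else if 4 ∣ m₂ then 1 + (2 / 5) * Fstar2 m₁
  else
    1 + (2 / 5) * Fstar2 m₁ + (2 / 5) * Fstar2 m₂ +
      ((moebius (Nat.gcd m₁ m₂) : ℚ) / 4) * Fstar1 (Nat.gcd m₁ m₂) *
        Fstar2 (Nat.lcm m₁ m₂ / Nat.gcd m₁ m₂)

section LocalFactors

variable {x : ℚ}

theorem denom_pos (hx : 2 ≤ x) : 0 < x ^ 5 - x ^ 4 - 3 * x ^ 3 + x ^ 2 + 4 * x + 1 := by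
  obtain ⟨t, rfl⟩ : ∃ t, x = t + 2 := ⟨x - 2, by ring⟩
  have ht : 0 ≤ t := by linarith
  ring_nf
  positivity

theorem factor1_pos (hx : 2 ≤ x) :
    0 < (x ^ 3 + x ^ 2 - 3 * x - 2) / (x ^ 5 - x ^ 4 - 3 * x ^ 3 + x ^ 2 + 4 * x + 1) := by
  refine div_pos ?_ (denom_pos hx)
  obtain ⟨t, rfl⟩ : ∃ t, x = t + 2 := ⟨x - 2, by ring⟩
  have ht : 0 ≤ t := by linarith
  ring_nf
  positivity

theorem factor2_pos (hx : 2 ≤ x) :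
    0 < (2 * x + 1) / (x ^ 5 - x ^ 4 - 3 * x ^ 3 + x ^ 2 + 4 * x + 1) :=
  div_pos (by linarith) (denom_pos hx)

theorem factor1_le_one (hx : 2 ≤ x) :
    (x ^ 3 + x ^ 2 - 3 * x - 2) / (x ^ 5 - x ^ 4 - 3 * x ^ 3 + x ^ 2 + 4 * x + 1) ≤ 1 := by
  rw [div_le_one (denom_pos hx), ← sub_nonneg]
  obtain ⟨t, rfl⟩ : ∃ t, x = t + 2 := ⟨x - 2, by ring⟩
  have ht : 0 ≤ t := by linarith
  ring_nf
  positivity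

theorem factor1_le_of_three_le (hx : 3 ≤ x) :
    (x ^ 3 + x ^ 2 - 3 * x - 2) / (x ^ 5 - x ^ 4 - 3 * x ^ 3 + x ^ 2 + 4 * x + 1) ≤ 25 / 103 := by
  rw [div_le_div_iff₀ (denom_pos (by linarith)) (by norm_num), ← sub_nonneg]
  obtain ⟨t, rfl⟩ : ∃ t, x = t + 3 := ⟨x - 3, by ring⟩
  have ht : 0 ≤ t := by linarith
  ring_nf
  positivity

theorem factor1_le_of_five_le (hx : 5 ≤ x) :
    (x ^ 3 + x ^ 2 - 3 * x - 2) / (x ^ 5 - x ^ 4 - 3 * x ^ 3 + x ^ 2 + 4 * x + 1) ≤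
      133 / 2171 := by
  rw [div_le_div_iff₀ (denom_pos (by linarith)) (by norm_num), ← sub_nonneg]
  obtain ⟨t, rfl⟩ : ∃ t, x = t + 5 := ⟨x - 5, by ring⟩
  have ht : 0 ≤ t := by linarith
  ring_nf
  positivity

theorem factor1_le_of_eleven_le (hx : 11 ≤ x) :
    (x ^ 3 + x ^ 2 - 3 * x - 2) / (x ^ 5 - x ^ 4 - 3 * x ^ 3 + x ^ 2 + 4 * x + 1) ≤
      1417 / 142583 := by
  rw [div_le_div_iff₀ (denom_pos (by linarith)) (by norm_num), ← sub_nonneg]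
  obtain ⟨t, rfl⟩ : ∃ t, x = t + 11 := ⟨x - 11, by ring⟩
  have ht : 0 ≤ t := by linarith
  ring_nf
  positivity

theorem factor2_le_one (hx : 2 ≤ x) :
    (2 * x + 1) / (x ^ 5 - x ^ 4 - 3 * x ^ 3 + x ^ 2 + 4 * x + 1) ≤ 1 := by
  rw [div_le_one (denom_pos hx), ← sub_nonneg]
  obtain ⟨t, rfl⟩ : ∃ t, x = t + 2 := ⟨x - 2, by ring⟩
  have ht : 0 ≤ t := by linarith
  ring_nf
  positivity

theorem factor2_le_of_three_le (hx : 3 ≤ x) :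
    (2 * x + 1) / (x ^ 5 - x ^ 4 - 3 * x ^ 3 + x ^ 2 + 4 * x + 1) ≤ 7 / 103 := by
  rw [div_le_div_iff₀ (denom_pos (by linarith)) (by norm_num), ← sub_nonneg]
  obtain ⟨t, rfl⟩ : ∃ t, x = t + 3 := ⟨x - 3, by ring⟩
  have ht : 0 ≤ t := by linarith
  ring_nf
  positivity

theorem factor2_le_of_five_le (hx : 5 ≤ x) :
    (2 * x + 1) / (x ^ 5 - x ^ 4 - 3 * x ^ 3 + x ^ 2 + 4 * x + 1) ≤ 11 / 2171 := by
  rw [div_le_div_iff₀ (denom_pos (by linarith)) (by norm_num), ← sub_nonneg]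
  obtain ⟨t, rfl⟩ : ∃ t, x = t + 5 := ⟨x - 5, by ring⟩
  have ht : 0 ≤ t := by linarith
  ring_nf
  positivity

end LocalFactors

theorem prod_primeFactors_le_of_dvd {f : ℕ → ℚ} (hf : ∀ p, p.Prime → 0 < f p)
    (hf' : ∀ p, p.Prime → f p ≤ 1) {d n : ℕ} (hdn : d ∣ n) (hn : n ≠ 0) :
    ∏ p ∈ n.primeFactors, f p ≤ ∏ p ∈ d.primeFactors, f p := by
  rw [← Finset.prod_sdiff (Nat.primeFactors_mono hdn hn)]
  refine mul_le_of_le_one_left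
    (Finset.prod_nonneg fun p hp => (hf p (Nat.prime_of_mem_primeFactors hp)).le)
    (Finset.prod_le_one (fun p hp => ?_) fun p hp => ?_)
  · exact (hf p (Nat.prime_of_mem_primeFactors (Finset.mem_sdiff.1 hp).1)).le
  · exact hf' p (Nat.prime_of_mem_primeFactors (Finset.mem_sdiff.1 hp).1)

theorem two_le_cast {p : ℕ} (hp : p.Prime) : (2 : ℚ) ≤ p := by exact_mod_cast hp.two_le

theorem Fstar1_pos (n : ℕ) : 0 < Fstar1 n :=
  Finset.prod_pos fun _ hp => factor1_pos (two_le_cast (Nat.prime_of_mem_primeFactors hp))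

theorem Fstar2_pos (n : ℕ) : 0 < Fstar2 n :=
  Finset.prod_pos fun _ hp => factor2_pos (two_le_cast (Nat.prime_of_mem_primeFactors hp))

theorem Fstar1_le_of_dvd {d n : ℕ} (hdn : d ∣ n) (hn : n ≠ 0) : Fstar1 n ≤ Fstar1 d :=
  prod_primeFactors_le_of_dvd (fun _ hp => factor1_pos (two_le_cast hp))
    (fun _ hp => factor1_le_one (two_le_cast hp)) hdn hn

theorem Fstar2_le_of_dvd {d n : ℕ} (hdn : d ∣ n) (hn : n ≠ 0) : Fstar2 n ≤ Fstar2 d :=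
  prod_primeFactors_le_of_dvd (fun _ hp => factor2_pos (two_le_cast hp))
    (fun _ hp => factor2_le_one (two_le_cast hp)) hdn hn

theorem Fstar1_one : Fstar1 1 = 1 := by simp [Fstar1]

theorem Fstar2_one : Fstar2 1 = 1 := by simp [Fstar2]

theorem Fstar2_le_one {n : ℕ} (hn : n ≠ 0) : Fstar2 n ≤ 1 :=
  Fstar2_one ▸ Fstar2_le_of_dvd (one_dvd n) hn

theorem Fstar1_prime {p : ℕ} (hp : p.Prime) :
    Fstar1 p = ((p : ℚ) ^ 3 + (p : ℚ) ^ 2 - 3 * p - 2) /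
      ((p : ℚ) ^ 5 - (p : ℚ) ^ 4 - 3 * (p : ℚ) ^ 3 + (p : ℚ) ^ 2 + 4 * p + 1) := by
  simp [Fstar1, hp.primeFactors]

theorem Fstar2_prime {p : ℕ} (hp : p.Prime) :
    Fstar2 p = (2 * (p : ℚ) + 1) /
      ((p : ℚ) ^ 5 - (p : ℚ) ^ 4 - 3 * (p : ℚ) ^ 3 + (p : ℚ) ^ 2 + 4 * p + 1) := by
  simp [Fstar2, hp.primeFactors]

theorem Fstar1_mul {a b : ℕ} (h : a.Coprime b) : Fstar1 (a * b) = Fstar1 a * Fstar1 b := by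
  rw [Fstar1, h.primeFactors_mul, Finset.prod_union h.disjoint_primeFactors, Fstar1, Fstar1]

theorem Fstar2_mul {a b : ℕ} (h : a.Coprime b) : Fstar2 (a * b) = Fstar2 a * Fstar2 b := by
  rw [Fstar2, h.primeFactors_mul, Finset.prod_union h.disjoint_primeFactors, Fstar2, Fstar2]

theorem Fstar1_two : Fstar1 2 = 4 / 5 := by rw [Fstar1_prime Nat.prime_two]; norm_num

theorem Fstar2_two : Fstar2 2 = 1 := by rw [Fstar2_prime Nat.prime_two]; norm_num

theorem Fstar1_three : Fstar1 3 = 25 / 103 := by rw [Fstar1_prime Nat.prime_three]; norm_num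

theorem Fstar2_three : Fstar2 3 = 7 / 103 := by rw [Fstar2_prime Nat.prime_three]; norm_num

theorem Fstar2_five : Fstar2 5 = 11 / 2171 := by rw [Fstar2_prime Nat.prime_five]; norm_num

theorem Fstar1_thirty_five : Fstar1 35 = 133 / 2171 * (369 / 13455) := by
  rw [show 35 = 5 * 7 from rfl, Fstar1_mul (by norm_num), Fstar1_prime Nat.prime_five,
    Fstar1_prime (by norm_num : Nat.Prime 7)]
  norm_num

theorem Fstar2_thirty_five : Fstar2 35 = 11 / 2171 * (1 / 897) := by
  rw [show 35 = 5 * 7 from rfl, Fstar2_mul (by norm_num), Fstar2_five,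
    Fstar2_prime (by norm_num : Nat.Prime 7)]
  norm_num

theorem Nat.Prime.three_le_of_dvd_odd {p n : ℕ} (hp : p.Prime) (hpn : p ∣ n) (hn : Odd n) :
    3 ≤ p := by
  have := hp.two_le
  have : p ≠ 2 := by rintro rfl; exact (Nat.not_even_iff_odd.2 hn) (even_iff_two_dvd.2 hpn)
  omega

theorem Nat.Prime.five_le_of_dvd_odd {p n : ℕ} (hp : p.Prime) (hpn : p ∣ n) (hn : Odd n)
    (h3 : ¬ 3 ∣ n) : 5 ≤ p := by
  have := hp.three_le_of_dvd_odd hpn hn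
  have : p ≠ 3 := by rintro rfl; exact h3 hpn
  have : p ≠ 4 := by rintro rfl; norm_num at hp
  omega

theorem Fstar1_le_of_odd {n : ℕ} (hn : Odd n) (h1 : n ≠ 1) : Fstar1 n ≤ 25 / 103 := by
  obtain ⟨p, hp, hpn⟩ := Nat.exists_prime_and_dvd h1
  refine (Fstar1_le_of_dvd hpn hn.pos.ne').trans ?_
  rw [Fstar1_prime hp]
  exact factor1_le_of_three_le (by exact_mod_cast hp.three_le_of_dvd_odd hpn hn)

theorem Fstar2_le_of_odd {n : ℕ} (hn : Odd n) (h1 : n ≠ 1) : Fstar2 n ≤ 7 / 103 := by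
  obtain ⟨p, hp, hpn⟩ := Nat.exists_prime_and_dvd h1
  refine (Fstar2_le_of_dvd hpn hn.pos.ne').trans ?_
  rw [Fstar2_prime hp]
  exact factor2_le_of_three_le (by exact_mod_cast hp.three_le_of_dvd_odd hpn hn)

theorem Fstar1_le_of_not_three_dvd {n : ℕ} (hn : Odd n) (h1 : n ≠ 1) (h3 : ¬ 3 ∣ n) :
    Fstar1 n ≤ 133 / 2171 := by
  obtain ⟨p, hp, hpn⟩ := Nat.exists_prime_and_dvd h1
  refine (Fstar1_le_of_dvd hpn hn.pos.ne').trans ?_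
  rw [Fstar1_prime hp]
  exact factor1_le_of_five_le (by exact_mod_cast hp.five_le_of_dvd_odd hpn hn h3)

theorem Fstar2_le_of_not_three_dvd {n : ℕ} (hn : Odd n) (h1 : n ≠ 1) (h3 : ¬ 3 ∣ n) :
    Fstar2 n ≤ 11 / 2171 := by
  obtain ⟨p, hp, hpn⟩ := Nat.exists_prime_and_dvd h1
  refine (Fstar2_le_of_dvd hpn hn.pos.ne').trans ?_
  rw [Fstar2_prime hp]
  exact factor2_le_of_five_le (by exact_mod_cast hp.five_le_of_dvd_odd hpn hn h3)

theorem eq_thirty_five_or_exists_large_prime {g : ℕ} (hg : Odd g) (hsf : Squarefree g)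
    (h3 : ¬ 3 ∣ g) (h1 : g ≠ 1) (hnp : ¬ g.Prime) :
    g = 35 ∨ ∃ p, p.Prime ∧ p ∣ g ∧ 11 ≤ p := by
  by_contra! h
  obtain ⟨h35, h⟩ := h
  have hsub : g.primeFactors ⊆ {5, 7} := by
    intro p hp
    have hpp := Nat.prime_of_mem_primeFactors hp
    have hpg := Nat.dvd_of_mem_primeFactors hp
    have h5 := hpp.five_le_of_dvd_odd hpg hg h3
    have h11 := h p hpp hpg
    interval_cases p <;> first | (simp; done) | norm_num at hpp
  have hdvd : g ∣ 35 := by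
    have := Finset.prod_dvd_prod_of_subset _ _ (fun p : ℕ => p) hsub
    rwa [Nat.prod_primeFactors_of_squarefree hsf] at this
  have hmem : g ∈ Nat.divisors 35 := by simp [hdvd]
  have hdiv : Nat.divisors 35 = {1, 5, 7, 35} := by decide
  rw [hdiv] at hmem
  simp only [Finset.mem_insert, Finset.mem_singleton] at hmem
  rcases hmem with rfl | rfl | rfl | rfl
  · exact h1 rfl
  · exact hnp (by norm_num)
  · exact hnp (by norm_num)
  · exact h35 rfl

theorem exists_coprime_cofactor {g p : ℕ} (hsf : Squarefree g) (hp : p.Prime) (hpg : p ∣ g)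
    (hnp : ¬ g.Prime) : ∃ h, g = p * h ∧ p.Coprime h ∧ h ≠ 1 := by
  obtain ⟨h, rfl⟩ := hpg
  refine ⟨h, rfl, Nat.coprime_of_squarefree_mul hsf, ?_⟩
  rintro rfl
  exact hnp (by simpa using hp)

/-- The variation `R(2gx, 2gy) - 1` for pairwise coprime odd `g`, `x`, `y`. -/
noncomputable def variation (g x y : ℕ) : ℚ :=
  2 / 5 * (Fstar2 g * Fstar2 x) + 2 / 5 * (Fstar2 g * Fstar2 y) -
    (ArithmeticFunction.moebius g : ℚ) / 5 * Fstar1 g * (Fstar2 x * Fstar2 y)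

theorem variation_comm (g x y : ℕ) : variation g x y = variation g y x := by
  unfold variation
  ring

section Variation

variable {g x y : ℕ}

theorem variation_lower_of_ne_one (hg : Odd g) (hx : Odd x) (hy : Odd y) (hsf : Squarefree g)
    (hgy : g.Coprime y) (hy1 : y ≠ 1) :
    -(102413 / 5014521525 : ℚ) ≤ variation g x y := by
  have hG1 := Fstar1_pos g
  have hG2 := Fstar2_pos g
  have hs := Fstar2_pos x
  have hs1 := Fstar2_le_one hx.pos.ne'
  have ht := Fstar2_pos y
  have ht1 := Fstar2_le_of_odd hy hy1
  have hst : Fstar2 x * Fstar2 y ≤ Fstar2 y := mul_le_of_le_one_left ht.le hs1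
  have hpos : 0 ≤ 2 / 5 * (Fstar2 g * Fstar2 x) + 2 / 5 * (Fstar2 g * Fstar2 y) := by positivity
  have small {u v : ℚ} (hu : Fstar1 g ≤ u) (hv : Fstar2 y ≤ v)
      (huv : u * v ≤ 102413 / 1002904305) :
      -(102413 / 5014521525 : ℚ) ≤
        2 / 5 * (Fstar2 g * Fstar2 x) + 2 / 5 * (Fstar2 g * Fstar2 y) -
          (1 : ℚ) / 5 * Fstar1 g * (Fstar2 x * Fstar2 y) := by
    have := (mul_le_mul hu (hst.trans hv) (by positivity) (hG1.le.trans hu)).trans huv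
    linarith
  unfold variation
  rcases ArithmeticFunction.moebius_eq_or g with hμ | hμ | hμ
  · rw [hμ]; push_cast; linarith
  · rw [hμ]
    push_cast
    by_cases hg1 : g = 1
    · subst hg1
      rw [Fstar1_one, Fstar2_one]
      linarith
    have hnp : ¬ g.Prime := fun hp => by
      rw [ArithmeticFunction.moebius_apply_prime hp] at hμ
      norm_num at hμ
    by_cases h3 : 3 ∣ g
    · obtain ⟨h, rfl, hco, hh1⟩ := exists_coprime_cofactor hsf Nat.prime_three h3 hnp
      have hh : Odd h := (Nat.odd_mul.1 hg).2
      have h3h : ¬ 3 ∣ h := (Nat.Prime.coprime_iff_not_dvd Nat.prime_three).1 hco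
      have h3y : ¬ 3 ∣ y := (Nat.Prime.coprime_iff_not_dvd Nat.prime_three).1
        (Nat.Coprime.coprime_dvd_left h3 hgy)
      refine small (u := 25 / 103 * (133 / 2171)) ?_
        (Fstar2_le_of_not_three_dvd hy hy1 h3y) (by norm_num)
      rw [Fstar1_mul hco, Fstar1_three]
      linarith [Fstar1_le_of_not_three_dvd hh hh1 h3h]
    rcases eq_thirty_five_or_exists_large_prime hg hsf h3 hg1 hnp with rfl | ⟨p, hp, hpg, h11⟩
    · rw [Fstar1_thirty_five, Fstar2_thirty_five]
      linarith [mul_nonneg (sub_nonneg.2 hs1) ht.le, mul_nonneg hs.le (sub_nonneg.2 ht1)]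
    · obtain ⟨h, rfl, hco, hh1⟩ := exists_coprime_cofactor hsf hp hpg hnp
      have hh : Odd h := (Nat.odd_mul.1 hg).2
      have h3h : ¬ 3 ∣ h := fun h' => h3 (h'.mul_left p)
      refine small (u := 1417 / 142583 * (133 / 2171)) ?_ ht1 (by norm_num)
      rw [Fstar1_mul hco, Fstar1_prime hp]
      exact mul_le_mul (factor1_le_of_eleven_le (by exact_mod_cast h11))
        (Fstar1_le_of_not_three_dvd hh hh1 h3h) (Fstar1_pos h).le (by norm_num)
  · rw [hμ]
    push_cast
    have : 0 < Fstar1 g * (Fstar2 x * Fstar2 y) := by positivity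
    linarith

theorem variation_one_upper (hx : Odd x) (hy : Odd y) (hx1 : x ≠ 1) (hy1 : y ≠ 1)
    (h3 : ¬ 3 ∣ y) : variation 1 x y ≤ 32583 / 1118065 := by
  have hs := Fstar2_le_of_odd hx hx1
  have ht := Fstar2_le_of_not_three_dvd hy hy1 h3
  have ht0 := Fstar2_pos y
  simp only [variation, Fstar1_one, Fstar2_one, ArithmeticFunction.moebius_apply_one,
    Int.cast_one]
  nlinarith

theorem variation_upper_of_ne_one (hg : Odd g) (hx : Odd x) (hy : Odd y) (hg1 : g ≠ 1)
    (hgy : g.Coprime y) (hy1 : y ≠ 1) : variation g x y ≤ 32583 / 1118065 := by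
  have hG1 := Fstar1_pos g
  have hG2 := Fstar2_pos g
  have hs := Fstar2_pos x
  have hs1 := Fstar2_le_one hx.pos.ne'
  have ht := Fstar2_pos y
  have bound {u v w : ℚ} (hu : Fstar1 g ≤ u) (hv : Fstar2 g ≤ v) (hw : Fstar2 y ≤ w)
      (h : 2 / 5 * v + 2 / 5 * (v * w) + 1 / 5 * (u * w) ≤ 32583 / 1118065) :
      variation g x y ≤ 32583 / 1118065 := by
    have h1 : Fstar2 g * Fstar2 x ≤ v := (mul_le_of_le_one_right hG2.le hs1).trans hv
    have h2 : Fstar2 g * Fstar2 y ≤ v * w := mul_le_mul hv hw ht.le (hG2.le.trans hv)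
    have h3 : Fstar1 g * (Fstar2 x * Fstar2 y) ≤ u * w :=
      mul_le_mul hu ((mul_le_of_le_one_left ht.le hs1).trans hw) (by positivity)
        (hG1.le.trans hu)
    have h4 : 0 < Fstar1 g * (Fstar2 x * Fstar2 y) := by positivity
    unfold variation
    rcases ArithmeticFunction.moebius_eq_or g with hμ | hμ | hμ <;> rw [hμ] <;> push_cast <;>
      linarith
  by_cases h3 : 3 ∣ g
  · have h3y : ¬ 3 ∣ y := (Nat.Prime.coprime_iff_not_dvd Nat.prime_three).1
      (Nat.Coprime.coprime_dvd_left h3 hgy)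
    exact bound (Fstar1_le_of_odd hg hg1) (Fstar2_le_of_odd hg hg1)
      (Fstar2_le_of_not_three_dvd hy hy1 h3y) (by norm_num)
  · exact bound (Fstar1_le_of_not_three_dvd hg hg1 h3) (Fstar2_le_of_not_three_dvd hg hg1 h3)
      (Fstar2_le_of_odd hy hy1) (by norm_num)

theorem variation_bounds (hg : Odd g) (hx : Odd x) (hy : Odd y) (hsf : Squarefree g)
    (hgx : g.Coprime x) (hgy : g.Coprime y) (hxy : x.Coprime y) (hgx1 : g * x ≠ 1)
    (hgy1 : g * y ≠ 1) (hne : x ≠ y) :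
    -(102413 / 5014521525 : ℚ) ≤ variation g x y ∧ variation g x y ≤ 32583 / 1118065 := by
  by_cases hg1 : g = 1
  · subst hg1
    rw [one_mul] at hgx1 hgy1
    refine ⟨variation_lower_of_ne_one hg hx hy hsf hgy hgy1, ?_⟩
    by_cases h3 : 3 ∣ y
    · rw [variation_comm]
      exact variation_one_upper hy hx hgy1 hgx1 ((Nat.Prime.coprime_iff_not_dvd
        Nat.prime_three).1 (Nat.Coprime.coprime_dvd_left h3 hxy.symm))
    · exact variation_one_upper hx hy hgx1 hgy1 h3
  by_cases hy1 : y = 1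
  · have hx1 : x ≠ 1 := fun h => hne (h.trans hy1.symm)
    rw [variation_comm]
    exact ⟨variation_lower_of_ne_one hg hy hx hsf hgx hx1,
      variation_upper_of_ne_one hg hy hx hg1 hgx hx1⟩
  · exact ⟨variation_lower_of_ne_one hg hx hy hsf hgy hy1,
      variation_upper_of_ne_one hg hx hy hg1 hgy hy1⟩

theorem not_four_dvd_two_mul {a : ℕ} (ha : Odd a) : ¬ 4 ∣ 2 * a := by
  obtain ⟨k, rfl⟩ := ha
  omega

theorem Rratio_eq_one_add_variation (hg : Odd g) (hx : Odd x) (hy : Odd y)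
    (hgx : g.Coprime x) (hgy : g.Coprime y) (hxy : x.Coprime y) :
    Rratio (2 * (g * x)) (2 * (g * y)) = 1 + variation g x y := by
  have h2 {n : ℕ} (hn : Odd n) : Nat.Coprime 2 n := Nat.coprime_two_left.2 hn
  have hgcd : Nat.gcd (2 * (g * x)) (2 * (g * y)) = 2 * g := by
    rw [Nat.gcd_mul_left, Nat.gcd_mul_left, hxy.gcd_eq_one, mul_one]
  have hlcm : Nat.lcm (2 * (g * x)) (2 * (g * y)) = 2 * g * (x * y) := by
    rw [Nat.lcm_mul_left, Nat.lcm_mul_left, hxy.lcm_eq_mul, mul_assoc]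
  rw [Rratio, if_neg (not_four_dvd_two_mul (hg.mul hx)),
    if_neg (not_four_dvd_two_mul (hg.mul hy)), hgcd, hlcm,
    Nat.mul_div_cancel_left _ (Nat.mul_pos two_pos hg.pos), Fstar2_mul (h2 (hg.mul hx)),
    Fstar2_mul (h2 (hg.mul hy)), Fstar2_mul hgx, Fstar2_mul hgy, Fstar2_mul hxy,
    Fstar1_mul (h2 hg), ArithmeticFunction.isMultiplicative_moebius.map_mul_of_coprime (h2 hg),
    ArithmeticFunction.moebius_apply_prime Nat.prime_two, Fstar1_two, Fstar2_two, variation]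
  push_cast
  ring

end Variation

theorem exists_eq_two_mul_odd_s18 {m : ℕ} (he : 2 ∣ m) (h4 : ¬ 4 ∣ m) (h6 : 6 ≤ m)
    (hsf : Squarefree (ordCompl[2] m)) :
    ∃ a, m = 2 * a ∧ Odd a ∧ Squarefree a ∧ a ≠ 1 := by
  obtain ⟨a, rfl⟩ := he
  have h2 : ¬ 2 ∣ a := by omega
  refine ⟨a, rfl, Nat.odd_iff.2 (by omega), ?_, by omega⟩
  rwa [Nat.ordCompl_mul, Nat.factorization_eq_zero_of_not_dvd h2, pow_zero, Nat.div_one,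
    Nat.prime_two.factorization_self, pow_one, Nat.div_self two_pos, one_mul] at hsf

theorem exists_coprime_decomposition {a b : ℕ} (ha : Squarefree a) (hb : Squarefree b) :
    ∃ g x y, a = g * x ∧ b = g * y ∧ g.Coprime x ∧ g.Coprime y ∧ x.Coprime y := by
  obtain ⟨x, y, hxy, hx, hy⟩ := Nat.exists_coprime a b
  rw [mul_comm] at hx hy
  refine ⟨Nat.gcd a b, x, y, hx, hy, ?_, ?_, hxy⟩
  · exact Nat.coprime_of_squarefree_mul (hx ▸ ha)
  · exact Nat.coprime_of_squarefree_mul (hy ▸ hb)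

theorem one_add_Fstar2_two_mul_bounds {a : ℕ} (ha : Odd a) (h1 : a ≠ 1) :
    (5014419112 / 5014521525 : ℚ) ≤ 1 + 2 / 5 * Fstar2 (2 * a) ∧
      1 + 2 / 5 * Fstar2 (2 * a) ≤ (1150648 / 1118065 : ℚ) := by
  rw [Fstar2_mul (Nat.coprime_two_left.2 ha), Fstar2_two]
  have := Fstar2_pos a
  have := Fstar2_le_of_odd ha h1
  constructor <;> linarith

theorem Rratio_seventy_two_hundred_ten :
    Rratio 70 210 = (5014419112 / 5014521525 : ℚ) := by
  have h := Rratio_eq_one_add_variation (g := 35) (x := 1) (y := 3) (by decide) (by decide)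
    (by decide) (by norm_num) (by norm_num) (by norm_num)
  norm_num only at h
  have hμ : ArithmeticFunction.moebius 35 = 1 := by
    rw [show 35 = 5 * 7 from rfl,
      ArithmeticFunction.isMultiplicative_moebius.map_mul_of_coprime (by norm_num),
      ArithmeticFunction.moebius_apply_prime (by norm_num),
      ArithmeticFunction.moebius_apply_prime (by norm_num)]
    norm_num
  rw [h, variation, hμ, Fstar1_thirty_five, Fstar2_thirty_five, Fstar2_one, Fstar2_three]
  norm_num

theorem Rratio_six_ten : Rratio 6 10 = (1150648 / 1118065 : ℚ) := by
  have h := Rratio_eq_one_add_variation (g := 1) (x := 3) (y := 5) (by decide) (by decide)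
    (by decide) (by norm_num) (by norm_num) (by norm_num)
  norm_num only at h
  rw [h, variation, ArithmeticFunction.moebius_apply_one, Fstar1_one, Fstar2_one, Fstar2_three,
    Fstar2_five]
  norm_num

/-- Let `m₁, m₂` be even integers, each at least 6, each with
squarefree odd part, and with `m₁ ≠ m₂`. Then
`5014419112/5014521525 ≤ R(m₁, m₂) ≤ 1150648/1118065`, and both bounds are attained:
`R(70, 210) = 5014419112/5014521525` and `R(6, 10) = 1150648/1118065`. -/
theorem Rratio_bounds (m₁ m₂ : ℕ) (he₁ : 2 ∣ m₁) (he₂ : 2 ∣ m₂)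
    (h₆₁ : 6 ≤ m₁) (h₆₂ : 6 ≤ m₂)
    (hsf₁ : Squarefree (ordCompl[2] m₁)) (hsf₂ : Squarefree (ordCompl[2] m₂))
    (hne : m₁ ≠ m₂) :
    ((5014419112 / 5014521525 : ℚ) ≤ Rratio m₁ m₂ ∧
      Rratio m₁ m₂ ≤ (1150648 / 1118065 : ℚ)) ∧
    Rratio 70 210 = (5014419112 / 5014521525 : ℚ) ∧
    Rratio 6 10 = (1150648 / 1118065 : ℚ) := by
  refine ⟨?_, Rratio_seventy_two_hundred_ten, Rratio_six_ten⟩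
  by_cases h₁ : 4 ∣ m₁ <;> by_cases h₂ : 4 ∣ m₂
  · rw [Rratio, if_pos h₁, if_pos h₂]
    norm_num
  · obtain ⟨a, rfl, ha, -, ha1⟩ := exists_eq_two_mul_odd_s18 he₂ h₂ h₆₂ hsf₂
    rw [Rratio, if_pos h₁, if_neg h₂]
    exact one_add_Fstar2_two_mul_bounds ha ha1
  · obtain ⟨a, rfl, ha, -, ha1⟩ := exists_eq_two_mul_odd_s18 he₁ h₁ h₆₁ hsf₁
    rw [Rratio, if_neg h₁, if_pos h₂]
    exact one_add_Fstar2_two_mul_bounds ha ha1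
  · obtain ⟨a, rfl, ha, hsa, ha1⟩ := exists_eq_two_mul_odd_s18 he₁ h₁ h₆₁ hsf₁
    obtain ⟨b, rfl, hb, hsb, hb1⟩ := exists_eq_two_mul_odd_s18 he₂ h₂ h₆₂ hsf₂
    obtain ⟨g, x, y, rfl, rfl, hgx, hgy, hxy⟩ := exists_coprime_decomposition hsa hsb
    obtain ⟨hg, hx⟩ := Nat.odd_mul.1 ha
    obtain ⟨-, hy⟩ := Nat.odd_mul.1 hb
    obtain ⟨hl, hu⟩ := variation_bounds hg hx hy hsa.of_mul_left hgx hgy hxy ha1 hb1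
      fun h => hne (by rw [h])
    rw [Rratio_eq_one_add_variation hg hx hy hgx hgy hxy]
    constructor <;> linarith
end

section
/- Let n be a squarefree positive integer and α ∈ (ℤ/nℤ)ˣ. Then |X_n^α| = ∏_{primes ℓ ∣ n, α ≡ 1 (mod ℓ)} ℓ² · ∏_{primes ℓ ∣ n, α ≢ 1 (mod ℓ)} (ℓ² + ℓ). -/
open Matrix

/-- The triples `(x, b, c)` with `x (β - x) = b c`. For `β = α - 1` they parametrize the
matrices with determinant `α` and eigenvalue `1`, via `x = M₀₀ - 1`, `b = M₀₁`, `c = M₁₀`. -/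
abbrev QuadricPoints (R : Type*) [CommRing R] (β : R) : Type _ :=
  {p : R × R × R // p.1 * (β - p.1) = p.2.1 * p.2.2}

/-- The matrix in `Xset n α` attached to a point of the quadric. -/
noncomputable def xsetEquivQuadricPoints (n : ℕ) (α : (ZMod n)ˣ) :
    Xset n α ≃ QuadricPoints (ZMod n) ((α : ZMod n) - 1) where
  toFun M := ⟨(M.1.1 0 0 - 1, M.1.1 0 1, M.1.1 1 0), by
    obtain ⟨M, h1, h2⟩ := M
    simp only [Matrix.det_fin_two, Matrix.sub_apply, Matrix.one_apply] at h1 h2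
    simp at h1 ⊢
    linear_combination h2 - (M.1 0 0) * (h2 - h1)⟩
  invFun p := 
    have h : (!![p.1.1 + 1, p.1.2.1; p.1.2.2, (α : ZMod n) - p.1.1]).det = (α : ZMod n) := by
      rw [Matrix.det_fin_two_of]
      linear_combination p.2
    ⟨Matrix.GeneralLinearGroup.mk'' !![p.1.1 + 1, p.1.2.1; p.1.2.2, (α : ZMod n) - p.1.1]
      (by rw [h]; exact α.isUnit), by
        refine ⟨?_, h⟩
        simp [Matrix.GeneralLinearGroup.mk'', Matrix.nonsingInvUnit, Matrix.det_fin_two]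
        linear_combination p.2⟩
  left_inv := by
    rintro ⟨M, h1, h2⟩
    have h3 : (α : ZMod n) - (M.1 0 0 - 1) = M.1 1 1 := by
      simp [Matrix.det_fin_two] at h1 h2
      linear_combination h1 - h2
    apply Subtype.ext
    apply Units.ext
    ext i j
    fin_cases i <;> fin_cases j <;>
      simp [Matrix.GeneralLinearGroup.mk'', Matrix.nonsingInvUnit, h3]
  right_inv p := by
    simp [Matrix.GeneralLinearGroup.mk'', Matrix.nonsingInvUnit]

/-- A ring isomorphism onto a product of rings splits the quadric into a product. -/
def quadricPointsEquivPi {ι R : Type*} {S : ι → Type*} [CommRing R] [∀ i, CommRing (S i)]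
    (e : R ≃+* ∀ i, S i) (β : R) :
    QuadricPoints R β ≃ ∀ i, QuadricPoints (S i) (e β i) where
  toFun p i := ⟨(e p.1.1 i, e p.1.2.1 i, e p.1.2.2 i), by
    simpa using congrFun (congrArg e p.2) i⟩
  invFun f := ⟨(e.symm fun i => (f i).1.1, e.symm fun i => (f i).1.2.1,
      e.symm fun i => (f i).1.2.2), by
    apply e.injective
    funext i
    simpa using (f i).2⟩
  left_inv p := by simp
  right_inv f := by simp

/-- The points of the quadric with `b ≠ 0`, where `c` is determined. -/
def quadricPointsNeZeroEquiv {K : Type*} [Field K] (β : K) :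
    {p : QuadricPoints K β // ¬ p.1.2.1 = 0} ≃ {b : K // b ≠ 0} × K where
  toFun p := (⟨p.1.1.2.1, p.2⟩, p.1.1.1)
  invFun q := ⟨⟨(q.2, q.1.1, q.2 * (β - q.2) / q.1.1), by
    have := q.1.2
    field_simp⟩, q.1.2⟩
  left_inv := by
    rintro ⟨⟨⟨x, b, c⟩, h⟩, hb⟩
    simp only at h hb
    simp [h, hb]
  right_inv q := rfl

/-- The points of the quadric with `b = 0`, where `c` is free. -/
def quadricPointsEqZeroEquiv {K : Type*} [Field K] [DecidableEq K] (β : K) :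
    {p : QuadricPoints K β // p.1.2.1 = 0} ≃ ({0, β} : Finset K) × K where
  toFun p := (⟨p.1.1.1, by
    obtain ⟨⟨⟨x, b, c⟩, h⟩, hb⟩ := p
    simp only at h hb
    simpa [hb, sub_eq_zero, eq_comm (a := β)] using h⟩, p.1.1.2.2)
  invFun q := ⟨⟨(q.1.1, 0, q.2), by
    obtain h | h : (q.1 : K) = 0 ∨ (q.1 : K) = β := by
      simpa only [Finset.mem_insert, Finset.mem_singleton] using q.1.2
    all_goals simp [h]⟩, rfl⟩
  left_inv := by
    rintro ⟨⟨⟨x, b, c⟩, h⟩, hb⟩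
    simp only at hb
    simp [hb]
  right_inv q := rfl

theorem card_quadricPoints {K : Type*} [Field K] [Finite K] [DecidableEq K] (β : K) :
    Nat.card (QuadricPoints K β) =
      if β = 0 then Nat.card K ^ 2 else Nat.card K ^ 2 + Nat.card K := by
  have := Fintype.ofFinite K
  rw [← Nat.card_congr (Equiv.sumCompl fun p : QuadricPoints K β => p.1.2.1 = 0), Nat.card_sum,
    Nat.card_congr (quadricPointsEqZeroEquiv β), Nat.card_congr (quadricPointsNeZeroEquiv β),
    Nat.card_prod, Nat.card_prod]
  have h : Nat.card {b : K // b ≠ 0} + 1 = Nat.card K := by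
    rw [Nat.card_eq_fintype_card, Nat.card_eq_fintype_card, Fintype.card_subtype_compl]
    have := Fintype.card_pos (α := K)
    simp
    omega
  rw [← h, Nat.card_eq_fintype_card, Fintype.card_coe]
  split_ifs with hβ
  · simp [hβ]
    ring
  · rw [Finset.card_pair (Ne.symm hβ)]
    ring

/-- The Chinese remainder theorem for a squarefree modulus. -/
noncomputable def zmodEquivPiPrimeFactors {n : ℕ} (hsf : Squarefree n) :
    ZMod n ≃+* ∀ ℓ : n.primeFactors, ZMod (ℓ : ℕ) :=
  (ZMod.ringEquivCongr (by
    rw [Finset.prod_coe_sort n.primeFactors fun ℓ => ℓ,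
      Nat.prod_primeFactors_of_squarefree hsf])).trans
    (ZMod.prodEquivPi (fun ℓ : n.primeFactors => (ℓ : ℕ)) fun p q hpq =>
      (Nat.coprime_primes (Nat.prime_of_mem_primeFactors p.2)
        (Nat.prime_of_mem_primeFactors q.2)).2 fun h => hpq (Subtype.ext h))

/-- Let `n` be a squarefree positive integer and `α ∈ (ℤ/nℤ)ˣ`. Then
`|X_n^α| = ∏_{primes ℓ ∣ n, α ≡ 1 (mod ℓ)} ℓ² ⬝ ∏_{primes ℓ ∣ n, α ≢ 1 (mod ℓ)} (ℓ² + ℓ)`,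
where `α ≡ 1 (mod ℓ)` means that the reduction of `α` modulo `ℓ` equals `1`
(the reduction being computed from the canonical lift `(α : ZMod n).val`, which
represents `α` modulo every divisor `ℓ` of `n`). -/
theorem card_Xset_squarefree (n : ℕ) [NeZero n] (hsf : Squarefree n) (α : (ZMod n)ˣ) :
    Nat.card (Xset n α) =
      (∏ ℓ ∈ n.primeFactors.filter
          (fun ℓ => (((α : ZMod n).val : ZMod ℓ) = 1)), ℓ ^ 2) *
      (∏ ℓ ∈ n.primeFactors.filter
          (fun ℓ => ¬(((α : ZMod n).val : ZMod ℓ) = 1)), (ℓ ^ 2 + ℓ)) := by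
  rw [Nat.card_congr ((xsetEquivQuadricPoints n α).trans
    (quadricPointsEquivPi (zmodEquivPiPrimeFactors hsf) _)), Nat.card_pi, ← Finset.prod_ite,
    ← Finset.prod_coe_sort n.primeFactors]
  refine Finset.prod_congr rfl fun ℓ _ => ?_
  have : Fact (ℓ : ℕ).Prime := ⟨Nat.prime_of_mem_primeFactors ℓ.2⟩
  have hα : zmodEquivPiPrimeFactors hsf (α : ZMod n) ℓ = ((α : ZMod n).val : ZMod ℓ) := by
    conv_lhs => rw [← ZMod.natCast_zmod_val (α : ZMod n), map_natCast]
    rfl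
  rw [card_quadricPoints, Nat.card_zmod, map_sub, map_one, Pi.sub_apply, Pi.one_apply, hα]
  simp only [sub_eq_zero]
end
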